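/- arXiv:2003.04373 — 2 statements merged into one kernel-verified Lean document; each statement's English description precedes it below -/
import Mathlib

section
/- Let p be a prime, k a field of characteristic p, and E = C_p × ⋯ × C_p (r factors). For every integer m ≥ 0 there exists a finite exact sequence of kE-modules 0 → P_n → ⋯ → P_1 → P_0 → k → 0 ending in the trivial module k, in which each P_i is a finite direct sum of permutation modules k(E/H) with H a product subgroup, i.e. H = K_1 × ⋯ × K_r with each K_j equal to either the trivial subgroup or the whole j-th factor C_p, and in which P_i is a free kE-module for i = 0, …, m. -/
open CategoryTheory DirectSum

/-- A subgroup of `E = (C_p)^r` is a *product subgroup* if it is of the form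
`K₁ × ⋯ × K_r` where each `K_j` is either trivial or the whole `j`-th factor. -/
def IsProductSubgroup (p r : ℕ) (H : Subgroup (Fin r → Multiplicative (ZMod p))) : Prop :=
  ∃ K : Fin r → Subgroup (Multiplicative (ZMod p)),
    (∀ j, K j = ⊥ ∨ K j = ⊤) ∧ H = Subgroup.pi Set.univ K

/-- A `kE`-module is a *product-permutation module* if it is a finite direct sum of
permutation modules `k(E/H)` with all `H` product subgroups of `E = (C_p)^r`. -/
def IsProductPermutationModule (p r : ℕ) (k : Type) [Field k]
    (P : Type) [AddCommGroup P]
    [Module (MonoidAlgebra k (Fin r → Multiplicative (ZMod p))) P] : Prop :=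
  ∃ (s : ℕ) (H : Fin s → Subgroup (Fin r → Multiplicative (ZMod p))),
    (∀ i, IsProductSubgroup p r (H i)) ∧
    Nonempty (P ≃ₗ[MonoidAlgebra k (Fin r → Multiplicative (ZMod p))]
      (⨁ i : Fin s, (Representation.ofMulAction k (Fin r → Multiplicative (ZMod p))
        ((Fin r → Multiplicative (ZMod p)) ⧸ H i)).asModule))

namespace ProductPermutationResolution

open scoped Matrix Kronecker

section FunctionRepresentation

variable (k : Type) [Field k] (G : Type) [Group G] (X : Type) [MulAction G X]

/-- The representation of `G` on the functions `X → k` on a `G`-set `X`. -/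
def functionRep : Representation k G (X → k) where
  toFun g := LinearMap.funLeft k k (g⁻¹ • ·)
  map_one' := by ext; simp [LinearMap.funLeft]
  map_mul' g g' := by
    refine LinearMap.ext fun f => funext fun x => ?_
    simp [LinearMap.funLeft, mul_smul]

variable {k G X}

theorem functionRep_apply (g : G) (f : X → k) (x : X) :
    functionRep k G X g f x = f (g⁻¹ • x) := rfl

theorem exists_equiv_directSum_of_bijective {ι : Type} [Fintype ι] (Z : ι → Type)
    [∀ i, Finite (Z i)] [∀ i, MulAction G (Z i)] (q : (Σ i, Z i) → X)
    (hq : Function.Bijective q) (hsmul : ∀ (i : ι) (g : G) (z : Z i), q ⟨i, g • z⟩ = g • q ⟨i, z⟩) :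
    Nonempty ((functionRep k G X).asModule ≃ₗ[MonoidAlgebra k G]
      ⨁ i, (Representation.ofMulAction k G (Z i)).asModule) := by
  classical
  let T (i : ι) : (X → k) →ₗ[k] MonoidAlgebra k (Z i) :=
    (MonoidAlgebra.coeffLinearEquiv k).symm.toLinearMap ∘ₗ
      (Finsupp.linearEquivFunOnFinite k k (Z i)).symm.toLinearMap ∘ₗ
        LinearMap.funLeft k k fun z => q ⟨i, z⟩
  have hT (i : ι) (f : X → k) (z : Z i) : (T i f).coeff z = f (q ⟨i, z⟩) := by
    simp [T, LinearMap.funLeft]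
  let I (i : ι) : (functionRep k G X).IntertwiningMap (Representation.ofMulAction k G (Z i)) :=
    ⟨T i, fun g => by
      refine LinearMap.ext fun f => MonoidAlgebra.ext <| Finsupp.ext fun z => ?_
      refine (hT i (functionRep k G X g f) z).trans <| Eq.trans ?_
        ((Representation.coeff_ofMulAction g (T i f) z).trans (hT i f (g⁻¹ • z))).symm
      rw [functionRep_apply, hsmul]⟩
  let Φ : (functionRep k G X).asModule →ₗ[MonoidAlgebra k G]
      (∀ i, (Representation.ofMulAction k G (Z i)).asModule) :=
    LinearMap.pi fun i => Representation.IntertwiningMap.equivLinearMapAsModule _ _ (I i)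
  have hΦ (f : X → k) (i : ι) (z : Z i) :
      (show MonoidAlgebra k (Z i) from Φ f i).coeff z = f (q ⟨i, z⟩) := hT i f z
  refine ⟨(LinearEquiv.ofBijective Φ ⟨fun f f' h => ?_, fun F => ?_⟩).trans
    (DirectSum.linearEquivFunOnFintype _ ι _).symm⟩
  · refine funext fun x => ?_
    obtain ⟨⟨i, z⟩, rfl⟩ := hq.2 x
    rw [← hΦ f i z, ← hΦ f' i z, h]
  · let e := Equiv.ofBijective q hq
    refine ⟨fun x => (show MonoidAlgebra k (Z (e.symm x).1) from F (e.symm x).1).coeff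
      (e.symm x).2, funext fun i => MonoidAlgebra.ext <| Finsupp.ext fun z => ?_⟩
    refine (hΦ _ i z).trans ?_
    have : e.symm (q ⟨i, z⟩) = ⟨i, z⟩ := e.symm_apply_apply ⟨i, z⟩
    rw [this]

variable (G X) in
theorem exists_bijective_ofQuotientStabilizer [Finite X] :
    ∃ (s : ℕ) (x : Fin s → X), Function.Bijective
      fun z : Σ i, G ⧸ MulAction.stabilizer G (x i) =>
        MulAction.ofQuotientStabilizer G (x z.1) z.2 := by
  obtain ⟨s, ⟨e⟩⟩ := Finite.exists_equiv_fin (MulAction.orbitRel.Quotient G X)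
  refine ⟨s, fun i => (e.symm i).out, ?_, fun x => ?_⟩
  · rintro ⟨i, z⟩ ⟨j, z'⟩ h
    have hij : i = j := by
      obtain ⟨g, rfl⟩ := QuotientGroup.mk_surjective z
      obtain ⟨g', rfl⟩ := QuotientGroup.mk_surjective z'
      simp only [MulAction.ofQuotientStabilizer_mk] at h
      have := congrArg (Quotient.mk (MulAction.orbitRel G X)) h
      have key (g : G) (y : X) : (Quotient.mk (MulAction.orbitRel G X) (g • y)) =
          Quotient.mk (MulAction.orbitRel G X) y := Quotient.sound ⟨g, rfl⟩
      rw [key, key, Quotient.out_eq, Quotient.out_eq] at this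
      exact e.symm.injective this
    subst hij
    exact congrArg _ (MulAction.injective_ofQuotientStabilizer G _ h)
  · let ω : MulAction.orbitRel.Quotient G X := Quotient.mk _ x
    obtain ⟨g, hg⟩ : MulAction.orbitRel G X x ω.out := Quotient.exact (Quotient.out_eq ω).symm
    refine ⟨⟨e ω, ((g : G) : G ⧸ MulAction.stabilizer G (e.symm (e ω)).out)⟩, ?_⟩
    simp only [MulAction.ofQuotientStabilizer_mk]
    rw [e.symm_apply_apply]
    exact hg

theorem exists_equiv_directSum_quotient [Finite G] [Finite X] :
    ∃ (s : ℕ) (x : Fin s → X), Nonempty ((functionRep k G X).asModule ≃ₗ[MonoidAlgebra k G]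
      ⨁ i, (Representation.ofMulAction k G (G ⧸ MulAction.stabilizer G (x i))).asModule) := by
  obtain ⟨s, x, hx⟩ := exists_bijective_ofQuotientStabilizer G X
  exact ⟨s, x, exists_equiv_directSum_of_bijective _ _ hx
    fun i g z => MulAction.ofQuotientStabilizer_smul G _ g z⟩

theorem free_functionRep [Finite G] [Finite X] (hX : ∀ (g : G) (x : X), g • x = x → g = 1) :
    Module.Free (MonoidAlgebra k G) (functionRep k G X).asModule := by
  obtain ⟨s, x, hx⟩ := exists_bijective_ofQuotientStabilizer G X
  have hmk (i : Fin s) :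
      Function.Bijective (QuotientGroup.mk : G → G ⧸ MulAction.stabilizer G (x i)) := by
    refine ⟨fun g g' h => ?_, QuotientGroup.mk_surjective⟩
    exact inv_mul_eq_one.1 (hX _ _ (QuotientGroup.eq.1 h))
  obtain ⟨Ψ⟩ := exists_equiv_directSum_of_bijective (k := k) (G := G) (X := X) (fun _ : Fin s => G)
    _ (hx.comp (Equiv.sigmaCongrRight fun i => Equiv.ofBijective _ (hmk i)).bijective)
    fun i g z => mul_smul g z (x i)
  have (i : Fin s) : Module.Free (MonoidAlgebra k G)
      (Representation.ofMulAction k G G).asModule :=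
    Module.Free.of_equiv Representation.ofMulActionSelfAsModuleEquiv.symm
  exact Module.Free.of_equiv Ψ.symm

end FunctionRepresentation

section Contraction

variable {k : Type} [Field k]

/-- The projection onto the base point `b` through the sum of the coefficients in degree zero. -/
def basepointProj (k : Type) [Field k] {W : Type} [DecidableEq W] (deg : W → ℕ) (b : W) :
    Matrix W W k :=
  Matrix.of fun w w' => if w = b ∧ deg w' = 0 then 1 else 0

/-- The matrix `d` is an equivariant differential of degree `-1` on the graded permutation
module with basis `W`, augmented by the sum of the coefficients in degree zero, and `h` is a
(not necessarily equivariant) contraction of the augmented complex. -/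
structure IsContractedComplex {G W : Type} [Fintype W] [DecidableEq W]
    (act : G → W → W) (deg : W → ℕ) (b : W) (d h : Matrix W W k) : Prop where
  deg_act : ∀ g w, deg (act g w) = deg w
  deg_base : deg b = 0
  d_deg : ∀ w w', d w w' ≠ 0 → deg w' = deg w + 1
  h_deg : ∀ w w', h w w' ≠ 0 → deg w = deg w' + 1
  act_injective : ∀ g, Function.Injective (act g)
  d_act : ∀ g w w', d (act g w) (act g w') = d w w'
  d_mul_d : d * d = 0
  proj_mul_d : basepointProj k deg b * d = 0
  homotopy : d * h + h * d = 1 - basepointProj k deg b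

theorem basepointProj_ne_zero {W : Type} [DecidableEq W] {deg : W → ℕ} {b w w' : W}
    (hw : basepointProj k deg b w w' ≠ 0) : w = b ∧ deg w' = 0 := by
  by_contra hne
  exact hw (by simp [basepointProj, hne])

theorem basepointProj_prod {W W' : Type} [DecidableEq W] [DecidableEq W'] (deg : W → ℕ)
    (deg' : W' → ℕ) (b : W) (b' : W') :
    basepointProj k (fun w : W × W' => deg w.1 + deg' w.2) (b, b') =
      basepointProj k deg b ⊗ₖ basepointProj k deg' b' := by
  ext ⟨w, w'⟩ ⟨v, v'⟩
  simp only [basepointProj, Matrix.kronecker_apply, Matrix.of_apply, Prod.mk.injEq, ← ite_and,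
    mul_ite, mul_one, mul_zero, Nat.add_eq_zero_iff]
  congr 1
  apply propext
  tauto

theorem neg_kronecker {l m n o : Type} (A : Matrix l m k) (B : Matrix n o k) :
    (-A) ⊗ₖ B = -(A ⊗ₖ B) := by
  ext
  simp

theorem sub_kronecker {l m n o : Type} (A A' : Matrix l m k) (B : Matrix n o k) :
    (A - A') ⊗ₖ B = A ⊗ₖ B - A' ⊗ₖ B := by
  ext
  simp [sub_mul]

variable {G G' W W' : Type} [Fintype W] [DecidableEq W] [Fintype W'] [DecidableEq W']
  {act : G → W → W} {act' : G' → W' → W'} {deg : W → ℕ} {deg' : W' → ℕ} {b : W} {b' : W'}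
  {d h : Matrix W W k} {d' h' : Matrix W' W' k}

/-- The grading involution. -/
def signMatrix (k : Type) [Field k] {W : Type} [DecidableEq W] (deg : W → ℕ) : Matrix W W k :=
  Matrix.diagonal fun w => (-1) ^ deg w

namespace IsContractedComplex

theorem d_mul_proj (H : IsContractedComplex act deg b d h) :
    d * basepointProj k deg b = 0 := by
  ext w w'
  rw [Matrix.mul_apply]
  refine Finset.sum_eq_zero fun v _ => ?_
  by_contra hne
  have h1 := H.d_deg _ _ (left_ne_zero_of_mul hne)
  rw [(basepointProj_ne_zero (right_ne_zero_of_mul hne)).1, H.deg_base] at h1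
  omega

theorem sign_mul_d (H : IsContractedComplex act deg b d h) :
    signMatrix k deg * d = -(d * signMatrix k deg) := by
  ext w w'
  simp only [signMatrix, Matrix.diagonal_mul, Matrix.mul_diagonal, Matrix.neg_apply]
  by_cases hd : d w w' = 0
  · simp [hd]
  · rw [H.d_deg _ _ hd]; ring

theorem sign_mul_h (H : IsContractedComplex act deg b d h) :
    signMatrix k deg * h = -(h * signMatrix k deg) := by
  ext w w'
  simp only [signMatrix, Matrix.diagonal_mul, Matrix.mul_diagonal, Matrix.neg_apply]
  by_cases hd : h w w' = 0
  · simp [hd]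
  · rw [H.h_deg _ _ hd]; ring

theorem sign_mul_proj (H : IsContractedComplex act deg b d h) :
    signMatrix k deg * basepointProj k deg b = basepointProj k deg b := by
  ext w w'
  simp only [signMatrix, Matrix.diagonal_mul]
  by_cases hd : basepointProj k deg b w w' = 0
  · simp [hd]
  · simp [(basepointProj_ne_zero hd).1, H.deg_base]

theorem proj_mul_sign : basepointProj k deg b * signMatrix k deg = basepointProj k deg b := by
  ext w w'
  simp only [signMatrix, Matrix.mul_diagonal]
  by_cases hd : basepointProj k deg b w w' = 0
  · simp [hd]
  · simp [(basepointProj_ne_zero hd).2]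

theorem prod (H : IsContractedComplex act deg b d h)
    (H' : IsContractedComplex act' deg' b' d' h') :
    IsContractedComplex (fun g : G × G' => Prod.map (act g.1) (act' g.2))
      (fun w => deg w.1 + deg' w.2) (b, b')
      (d ⊗ₖ 1 + signMatrix k deg ⊗ₖ d') (h ⊗ₖ 1 + basepointProj k deg b ⊗ₖ h') where
  deg_act g w := by simp [H.deg_act, H'.deg_act]
  deg_base := by simp [H.deg_base, H'.deg_base]
  d_deg := by
    rintro ⟨w, w'⟩ ⟨v, v'⟩ hne
    simp only [Matrix.add_apply, Matrix.kronecker_apply, signMatrix, Matrix.one_apply,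
      Matrix.diagonal_apply] at hne ⊢
    by_cases h1 : d w v = 0
    · rw [h1, zero_mul, zero_add] at hne
      have := H'.d_deg _ _ (right_ne_zero_of_mul hne)
      have := left_ne_zero_of_mul hne
      simp only [ne_eq, ite_eq_right_iff, Classical.not_imp] at this
      rw [this.1]; omega
    · have h2 := H.d_deg _ _ h1
      have h3 : w' = v' := by
        by_contra h3
        have h4 : w ≠ v := by rintro rfl; omega
        simp [h3, h4] at hne
      rw [h3]; omega
  h_deg := by
    rintro ⟨w, w'⟩ ⟨v, v'⟩ hne
    simp only [Matrix.add_apply, Matrix.kronecker_apply, Matrix.one_apply] at hne ⊢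
    by_cases h1 : basepointProj k deg b w v = 0
    · rw [h1, zero_mul, add_zero] at hne
      have := H.h_deg _ _ (left_ne_zero_of_mul hne)
      have := right_ne_zero_of_mul hne
      simp only [ne_eq, ite_eq_right_iff, Classical.not_imp] at this
      rw [this.1]; omega
    · have h2 := basepointProj_ne_zero h1
      have h3 : h w v = 0 := by
        by_contra h3
        have := H.h_deg _ _ h3
        rw [h2.1, H.deg_base] at this
        omega
      rw [h3, zero_mul, zero_add] at hne
      have := H'.h_deg _ _ (right_ne_zero_of_mul hne)
      rw [h2.1, H.deg_base, h2.2]; omega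
  act_injective g := (H.act_injective _).prodMap (H'.act_injective _)
  d_act := by
    rintro ⟨g, g'⟩ ⟨w, w'⟩ ⟨v, v'⟩
    simp [signMatrix, Matrix.one_apply, Matrix.diagonal_apply,
      H.d_act, H'.d_act, H.deg_act, (H.act_injective _).eq_iff, (H'.act_injective _).eq_iff]
  d_mul_d := by
    simp only [mul_add, add_mul, ← Matrix.mul_kronecker_mul, H.d_mul_d, H'.d_mul_d, H.sign_mul_d,
      Matrix.zero_kronecker, Matrix.kronecker_zero, one_mul, mul_one, neg_kronecker]
    simp
  proj_mul_d := by
    simp only [basepointProj_prod, mul_add, ← Matrix.mul_kronecker_mul, H.proj_mul_d,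
      H'.proj_mul_d, Matrix.zero_kronecker, Matrix.kronecker_zero, add_zero]
  homotopy := by
    have e : (basepointProj k deg b ⊗ₖ (1 : Matrix W' W' k)) =
        basepointProj k deg b ⊗ₖ (d' * h' + h' * d') +
          basepointProj k deg b ⊗ₖ basepointProj k deg' b' := by
      rw [H'.homotopy, ← Matrix.kronecker_add, sub_add_cancel]
    have e' : (d * h) ⊗ₖ (1 : Matrix W' W' k) + (h * d) ⊗ₖ (1 : Matrix W' W' k) =
        1 - basepointProj k deg b ⊗ₖ (1 : Matrix W' W' k) := by
      rw [← Matrix.add_kronecker, H.homotopy, sub_kronecker, Matrix.one_kronecker_one]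
    rw [e, Matrix.kronecker_add] at e'
    simp only [basepointProj_prod, mul_add, add_mul, ← Matrix.mul_kronecker_mul, H.proj_mul_d,
      H.d_mul_proj, H.sign_mul_h, H.sign_mul_proj, proj_mul_sign,
      Matrix.zero_kronecker, one_mul, mul_one, neg_kronecker]
    rw [eq_sub_iff_add_eq] at e' ⊢
    rw [← e']
    abel

theorem of_equiv {G₂ W₂ : Type} [Fintype W₂] [DecidableEq W₂] {act₂ : G₂ → W₂ → W₂}
    (H : IsContractedComplex act deg b d h) (φ : G₂ → G) (ψ : W₂ ≃ W)
    (hψ : ∀ g w, ψ (act₂ g w) = act (φ g) (ψ w)) :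
    IsContractedComplex act₂ (fun w => deg (ψ w)) (ψ.symm b) (d.submatrix ψ ψ)
      (h.submatrix ψ ψ) := by
  have hp : basepointProj k (fun w => deg (ψ w)) (ψ.symm b) =
      (basepointProj k deg b).submatrix ψ ψ := by
    ext w w'
    simp [basepointProj, Equiv.eq_symm_apply]
  refine ⟨fun g w => ?_, ?_, fun w w' => H.d_deg _ _, fun w w' => H.h_deg _ _,
    fun g w w' hw => ?_, fun g w w' => ?_, ?_, ?_, ?_⟩
  · simp only [hψ, H.deg_act]
  · simp [H.deg_base]
  · refine ψ.injective (H.act_injective (φ g) ?_)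
    rw [← hψ, ← hψ, hw]
  · simp only [Matrix.submatrix_apply, hψ, H.d_act]
  · rw [Matrix.submatrix_mul_equiv, H.d_mul_d]; rfl
  · rw [hp, Matrix.submatrix_mul_equiv, H.proj_mul_d]; rfl
  · have := congrArg (fun A => Matrix.submatrix A ψ ψ) H.homotopy
    simpa [hp, Matrix.submatrix_mul_equiv, Matrix.submatrix_add, Matrix.submatrix_sub] using this

theorem exists_pi (H : IsContractedComplex act deg b d h) (r : ℕ) :
    ∃ d' h' : Matrix (Fin r → W) (Fin r → W) k,
      IsContractedComplex (fun (g : Fin r → G) w j => act (g j) (w j))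
        (fun w => ∑ j, deg (w j)) (fun _ => b) d' h' := by
  induction r with
  | zero =>
    refine ⟨0, 0, ?_⟩
    constructor <;> simp
    · intro w w' _
      exact Subsingleton.elim _ _
    · ext w w'
      simp [basepointProj, Subsingleton.elim w w', Subsingleton.elim w' (fun _ => b)]
  | succ r ih =>
    obtain ⟨d', h', H'⟩ := ih
    have := (H.prod H').of_equiv
      (act₂ := fun (g : Fin (r + 1) → G) (w : Fin (r + 1) → W) j => act (g j) (w j))
      (fun g => (g 0, Fin.tail g)) (Fin.consEquiv fun _ => W).symm fun g w => rfl
    have hdeg : (fun w : Fin (r + 1) → W => ∑ j, deg (w j)) =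
        fun w => deg ((Fin.consEquiv fun _ => W).symm w).1 +
          ∑ j, deg (((Fin.consEquiv fun _ => W).symm w).2 j) :=
      funext fun w => Fin.sum_univ_succ _
    have hb : (fun _ : Fin (r + 1) => b) =
        (Fin.consEquiv fun _ => W).symm.symm (b, fun _ => b) := by
      refine funext fun j => ?_
      cases j using Fin.cases <;> rfl
    rw [hdeg, hb]
    exact ⟨_, _, this⟩

end IsContractedComplex

end Contraction

section Cell

variable (p L : ℕ)

/-- The basis of the periodic complex `k → k C_p → ⋯ → k C_p` with `L` free terms. -/
abbrev Cell : Type := Option (Fin L × ZMod p)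

/-- The degree of a basis element of the periodic complex. -/
def Cell.deg : Cell p L → ℕ
  | some (a, _) => a
  | none => L

/-- Translation of the basis elements of the periodic complex. -/
def Cell.act (g : Multiplicative (ZMod p)) : Cell p L → Cell p L
  | some (a, c) => some (a, g.toAdd + c)
  | none => none

theorem Cell.deg_act (g : Multiplicative (ZMod p)) (w : Cell p L) :
    Cell.deg p L (Cell.act p L g w) = Cell.deg p L w := by
  obtain _ | ⟨a, c⟩ := w <;> rfl

theorem Cell.act_eq_self_iff (g : Multiplicative (ZMod p)) (w : Cell p L) :
    Cell.act p L g w = w ↔ w = none ∨ g = 1 := by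
  obtain _ | ⟨a, c⟩ := w <;> simp [Cell.act]

end Cell

section CyclicGroup

variable (k : Type) [Field k] (p : ℕ) [Fact p.Prime]

/-- Multiplication by `g - 1` on the group algebra of a cyclic group with generator `g`. -/
def genSubOne : Matrix (ZMod p) (ZMod p) k :=
  Matrix.of fun c c' => (if c' = c - 1 then 1 else 0) - if c' = c then 1 else 0

/-- Multiplication by the norm element on the group algebra of a cyclic group. -/
def normMatrix : Matrix (ZMod p) (ZMod p) k := Matrix.of fun _ _ => 1

/-- The contraction sending `g ^ i` to `1 + g + ⋯ + g ^ (i - 1)`. -/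
def partialSums : Matrix (ZMod p) (ZMod p) k :=
  Matrix.of fun c c' => if c.val < c'.val then 1 else 0

/-- The contraction sending `g ^ (p - 1)` to `1` and the other group elements to `0`. -/
def lastToOne : Matrix (ZMod p) (ZMod p) k :=
  Matrix.of fun c c' => if c = 0 ∧ c' = -1 then 1 else 0

theorem val_add_one (c : ZMod p) (hc : c ≠ -1) : (c + 1).val = c.val + 1 := by
  have hp := (Fact.out : p.Prime).one_lt
  have : Fact (1 < p) := ⟨hp⟩
  refine (ZMod.val_add_of_lt ?_).trans (by rw [ZMod.val_one])
  rw [ZMod.val_one]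
  have := ZMod.val_lt c
  by_contra! h
  refine hc ?_
  rw [← ZMod.natCast_zmod_val c, eq_neg_iff_add_eq_zero]
  exact_mod_cast (ZMod.natCast_eq_zero_iff _ _).2 (by
    rw [show c.val + 1 = p by omega])

theorem val_neg_one_add_one : (-1 : ZMod p).val + 1 = p := by
  obtain ⟨n, rfl⟩ := Nat.exists_eq_succ_of_ne_zero (Fact.out : p.Prime).ne_zero
  rw [ZMod.val_neg_one]

theorem genSubOne_mul_normMatrix : genSubOne k p * normMatrix k p = 0 := by
  ext c c'
  simp [Matrix.mul_apply, genSubOne, normMatrix]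

theorem sum_genSubOne (c' : ZMod p) : ∑ c, genSubOne k p c c' = 0 := by
  simp [genSubOne, eq_sub_iff_add_eq]

theorem normMatrix_mul_genSubOne : normMatrix k p * genSubOne k p = 0 := by
  ext c c'
  simp [Matrix.mul_apply, normMatrix, sum_genSubOne]

theorem lastToOne_mul_normMatrix (c c' : ZMod p) :
    (lastToOne k p * normMatrix k p) c c' = if c = 0 then 1 else 0 := by
  simp [Matrix.mul_apply, normMatrix, lastToOne, ite_and]

theorem normMatrix_mul_lastToOne (c c' : ZMod p) :
    (normMatrix k p * lastToOne k p) c c' = if c' = -1 then 1 else 0 := by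
  simp [Matrix.mul_apply, normMatrix, lastToOne, ite_and]

theorem genSubOne_mul_partialSums (c c' : ZMod p) :
    (genSubOne k p * partialSums k p) c c' = (if c = c' then 1 else 0) - if c = 0 then 1 else 0 := by
  have h : (genSubOne k p * partialSums k p) c c' =
      (if (c - 1).val < c'.val then 1 else 0) - if c.val < c'.val then 1 else 0 := by
    simp [Matrix.mul_apply, genSubOne, partialSums, sub_mul, -mul_ite]
  rw [h]
  have hc' := ZMod.val_lt c'
  by_cases hc : c = 0
  · have := val_neg_one_add_one p
    subst hc
    simp only [zero_sub, ZMod.val_zero, if_true, ← (ZMod.val_injective p).eq_iff]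
    rw [if_neg (by omega)]
    split_ifs <;> first | omega | simp
  · have := val_add_one p (c - 1) (by rwa [ne_eq, sub_eq_iff_eq_add, neg_add_cancel])
    rw [sub_add_cancel] at this
    simp only [hc, if_false, ← (ZMod.val_injective p).eq_iff]
    split_ifs <;> first | omega | simp

theorem norm_mul_last_add_partialSums_mul_gen (c c' : ZMod p) :
    (normMatrix k p * lastToOne k p) c c' + (partialSums k p * genSubOne k p) c c' =
      if c = c' then 1 else 0 := by
  have h : (partialSums k p * genSubOne k p) c c' =
      (if c.val < (c' + 1).val then 1 else 0) - if c.val < c'.val then 1 else 0 := by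
    simp [Matrix.mul_apply, genSubOne, partialSums, mul_sub, eq_sub_iff_add_eq]
  rw [h, normMatrix_mul_lastToOne]
  have hc := ZMod.val_lt c
  by_cases hc' : c' = -1
  · have := val_neg_one_add_one p
    subst hc'
    simp only [neg_add_cancel, ZMod.val_zero, if_true, ← (ZMod.val_injective p).eq_iff]
    rw [if_neg (by omega)]
    split_ifs <;> first | omega | simp
  · have := val_add_one p c' hc'
    simp only [hc', if_false, ← (ZMod.val_injective p).eq_iff]
    split_ifs <;> first | omega | simp

variable (L : ℕ)

/-- The block of the differential of the periodic complex from degree `b` to degree `a`. -/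
def dBlock (a b : ℕ) : Matrix (ZMod p) (ZMod p) k :=
  if b = a + 1 then if Even a then genSubOne k p else normMatrix k p else 0

/-- The block of the contraction of the periodic complex from degree `b` to degree `a`. -/
def hBlock (a b : ℕ) : Matrix (ZMod p) (ZMod p) k :=
  if a = b + 1 then if Even b then partialSums k p else lastToOne k p else 0

/-- The differential of the periodic complex. -/
def cellD : Matrix (Cell p L) (Cell p L) k := Matrix.of fun
  | some (a, c), some (b, c') => dBlock k p a b c c'
  | some (a, _), none => if (a : ℕ) + 1 = L then 1 else 0
  | none, _ => 0

/-- The contraction of the periodic complex. -/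
def cellH : Matrix (Cell p L) (Cell p L) k := Matrix.of fun
  | some (a, c), some (b, c') => hBlock k p a b c c'
  | none, some (b, c') => if (b : ℕ) + 1 = L ∧ c' = -1 then 1 else 0
  | _, none => 0

theorem dBlock_mul_dBlock (a b c : ℕ) : dBlock k p a b * dBlock k p b c = 0 := by
  unfold dBlock
  split_ifs with h1 h2 h3 h4 <;>
    simp_all [genSubOne_mul_normMatrix, normMatrix_mul_genSubOne, Nat.even_add_one]

theorem sum_dBlock_mul_hBlock (a b : Fin L) :
    ∑ x : Fin L, dBlock k p a x * hBlock k p x b =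
      if a = b ∧ (a : ℕ) + 1 < L then
        if Even (a : ℕ) then genSubOne k p * partialSums k p else normMatrix k p * lastToOne k p
      else 0 := by
  by_cases h : (a : ℕ) + 1 < L
  · rw [Finset.sum_eq_single ⟨a + 1, h⟩ (fun x _ hx => ?_) (by simp)]
    · by_cases hab : a = b
      · subst hab
        simp only [dBlock, hBlock, h, and_self, if_true]
        split_ifs <;> rfl
      · simp [hBlock, hab, Fin.val_inj]
    · rw [dBlock, if_neg (fun e => hx (Fin.ext e)), zero_mul]
  · rw [if_neg (fun e => h e.2)]
    refine Finset.sum_eq_zero fun x _ => ?_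
    rw [dBlock, if_neg (by omega), zero_mul]

theorem sum_hBlock_mul_dBlock (a b : Fin L) :
    ∑ x : Fin L, hBlock k p a x * dBlock k p x b =
      if a = b ∧ 0 < (a : ℕ) then
        if Even (a : ℕ) then lastToOne k p * normMatrix k p else partialSums k p * genSubOne k p
      else 0 := by
  obtain ⟨_ | a, ha⟩ := a
  · simp [hBlock]
  · rw [Finset.sum_eq_single ⟨a, by omega⟩ (fun x _ hx => ?_) (by simp)]
    · by_cases hab : b = ⟨a + 1, ha⟩
      · subst hab
        simp only [dBlock, hBlock, Nat.even_add_one]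
        by_cases he : Even a <;> simp [he]
      · rw [if_neg (fun e => hab e.1.symm), dBlock, if_neg (fun e => hab (Fin.ext e)), mul_zero]
    · rw [hBlock, if_neg (fun e => hx (Fin.ext (Nat.succ_injective e).symm)), zero_mul]

theorem cell_mul_apply (A B : Matrix (Cell p L) (Cell p L) k) (w w' : Cell p L) :
    (A * B) w w' = A w none * B none w' +
      ∑ a : Fin L, ∑ c : ZMod p, A w (some (a, c)) * B (some (a, c)) w' := by
  rw [Matrix.mul_apply, Fintype.sum_option, Fintype.sum_prod_type]

theorem isContractedComplex_cell (hL : Even L) (hL0 : 0 < L) :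
    IsContractedComplex (Cell.act p L) (Cell.deg p L) (some (⟨0, hL0⟩, 0))
      (cellD k p L) (cellH k p L) where
  deg_act := Cell.deg_act p L
  deg_base := rfl
  d_deg := by
    rintro (_ | ⟨a, c⟩) (_ | ⟨b, c'⟩) hne
    · simp [cellD] at hne
    · simp [cellD] at hne
    · simp only [cellD, Matrix.of_apply, ne_eq, ite_eq_right_iff, Classical.not_imp] at hne
      exact hne.1.symm
    · by_contra h
      refine hne ?_
      have h : ¬ (b : ℕ) = a + 1 := h
      simp [cellD, dBlock, h]
  h_deg := by
    rintro (_ | ⟨a, c⟩) (_ | ⟨b, c'⟩) hne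
    · simp [cellH] at hne
    · simp only [cellH, Matrix.of_apply, ne_eq, ite_eq_right_iff, Classical.not_imp] at hne
      exact hne.1.1.symm
    · simp [cellH] at hne
    · by_contra h
      refine hne ?_
      have h : ¬ (a : ℕ) = b + 1 := h
      simp [cellH, hBlock, h]
  act_injective g := by
    rintro (_ | ⟨a, c⟩) (_ | ⟨b, c'⟩) h <;> simp_all [Cell.act]
  d_act g := by
    rintro (_ | ⟨a, c⟩) (_ | ⟨b, c'⟩) <;> simp only [Cell.act, cellD, Matrix.of_apply]
    unfold dBlock
    split_ifs
    · simp [genSubOne, add_sub_assoc]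
    · rfl
    · rfl
  d_mul_d := by
    ext w w'
    rw [cell_mul_apply]
    obtain _ | ⟨a, c⟩ := w
    · simp [cellD]
    obtain _ | ⟨b, c'⟩ := w'
    · simp only [cellD, Matrix.of_apply, mul_zero, zero_add, Matrix.zero_apply]
      refine Finset.sum_eq_zero fun x _ => ?_
      split_ifs with hx
      · simp only [mul_one, dBlock]
        split_ifs with h1 h2
        · have := congrFun₂ (genSubOne_mul_normMatrix k p) c 0
          simpa [Matrix.mul_apply, normMatrix] using this
        · rw [← hx, h1, Nat.even_add_one, Nat.even_add_one] at hL
          tauto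
        · simp
      · simp
    · simp only [cellD, Matrix.of_apply, mul_zero, zero_add, Matrix.zero_apply]
      refine Finset.sum_eq_zero fun x _ => ?_
      rw [← Matrix.mul_apply, dBlock_mul_dBlock]; rfl
  proj_mul_d := by
    ext w w'
    rw [cell_mul_apply, Finset.sum_eq_single ⟨0, hL0⟩ (fun x _ hx => ?_) (by simp)]
    · by_cases hw : w = some (⟨0, hL0⟩, 0)
      · obtain _ | ⟨b, c'⟩ := w'
        · have : 1 ≠ L := by rintro rfl; simp at hL
          simp [basepointProj, cellD, Cell.deg, this]
        · simp only [basepointProj, cellD, Cell.deg, dBlock, Matrix.of_apply, hw, true_and, if_true,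
            one_mul, mul_zero, zero_add, Even.zero, Matrix.zero_apply]
          split_ifs
          · exact sum_genSubOne k p c'
          · simp
      · simp [basepointProj, hw]
    · refine Finset.sum_eq_zero fun c _ => ?_
      have hx : ¬ (x : ℕ) = 0 := fun e => hx (Fin.ext e)
      simp [basepointProj, Cell.deg, hx]
  homotopy := by
    ext w w'
    rw [Matrix.add_apply, cell_mul_apply, cell_mul_apply]
    obtain _ | ⟨a, c⟩ := w <;> obtain _ | ⟨b, c'⟩ := w'
    · have key : ∑ x : Fin L, ∑ c : ZMod p,
          cellH k p L none (some (x, c)) * cellD k p L (some (x, c)) none = 1 := by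
        rw [Finset.sum_eq_single ⟨L - 1, by omega⟩ (fun x _ hx => ?_) (by simp)]
        · simp [cellH, cellD, Nat.sub_add_cancel hL0]
        · have hx : ¬ (x : ℕ) + 1 = L := fun e => hx (Fin.ext (by simp [← e]))
          simp [cellD, hx]
      rw [key]
      simp [cellD, cellH, basepointProj]
    · have key (x : Fin L) (c : ZMod p) :
          cellH k p L none (some (x, c)) * cellD k p L (some (x, c)) (some (b, c')) = 0 := by
        simp only [cellH, cellD, dBlock, Matrix.of_apply]
        split_ifs <;> first | omega | simp
      simp only [key]
      simp [cellD, cellH, basepointProj]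
    · have key (x : Fin L) (c' : ZMod p) :
          cellH k p L (some (a, c)) (some (x, c')) * cellD k p L (some (x, c')) none = 0 := by
        simp only [cellH, cellD, hBlock, Matrix.of_apply]
        split_ifs <;> first | omega | simp
      simp only [key]
      simp [cellD, cellH, basepointProj, Cell.deg, hL0.ne']
    · simp only [cellD, cellH, Matrix.of_apply, zero_mul, zero_add, ← Matrix.mul_apply]
      rw [← Matrix.sum_apply, ← Matrix.sum_apply, sum_dBlock_mul_hBlock, sum_hBlock_mul_dBlock]
      by_cases hab : a = b
      · subst hab
        by_cases he : Even (a : ℕ)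
        · have h1 : (a : ℕ) + 1 < L := by
            refine lt_of_le_of_ne a.2 fun e => ?_
            rw [← e, Nat.even_add_one] at hL
            exact hL he
          by_cases h0 : (a : ℕ) = 0
          · obtain rfl : a = ⟨0, hL0⟩ := Fin.ext h0
            have h1 : 1 < L := h1
            simp [h1, h1.ne, genSubOne_mul_partialSums, basepointProj, Cell.deg, Matrix.one_apply]
          · have h0' : a ≠ ⟨0, hL0⟩ := fun e => h0 (congrArg Fin.val e)
            simp [h0, h0', h1, he, h1.ne, Nat.pos_of_ne_zero h0, genSubOne_mul_partialSums,
              lastToOne_mul_normMatrix, basepointProj, Cell.deg, Matrix.one_apply]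
        · have h0 : (a : ℕ) ≠ 0 := fun e => he (by simp [e])
          have h0' : a ≠ ⟨0, hL0⟩ := fun e => h0 (congrArg Fin.val e)
          have key := norm_mul_last_add_partialSums_mul_gen k p c c'
          have hr : (1 - basepointProj k (Cell.deg p L) (some (⟨0, hL0⟩, 0)))
              (some (a, c)) (some (a, c')) = if c = c' then 1 else 0 := by
            simp [basepointProj, h0', Matrix.one_apply]
          rw [hr, ← key]
          by_cases h1 : (a : ℕ) + 1 = L
          · simp [h1, he, Nat.pos_of_ne_zero h0, normMatrix_mul_lastToOne]
          · simp [h1, lt_of_le_of_ne a.2 h1, he, Nat.pos_of_ne_zero h0]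
      · have hab' : a = ⟨0, hL0⟩ → ¬ (b : ℕ) = 0 := fun e e' => hab (e.trans (Fin.ext e'.symm))
        have h2 : ¬ ((a : ℕ) + 1 = L ∧ (b : ℕ) + 1 = L) := fun e => hab (Fin.ext (by omega))
        have h3 : (1 - basepointProj k (Cell.deg p L) (some (⟨0, hL0⟩, 0)))
              (some (a, c)) (some (b, c')) = 0 := by
          simp [basepointProj, hab, Cell.deg]
          tauto
        rw [h3]
        simp only [hab, false_and, if_false, Matrix.zero_apply, add_zero]
        split_ifs <;> first | omega | simp

end CyclicGroup

section Resolution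

variable (p L r : ℕ)

/-- The basis of the degree `n` part of the `r`-fold tensor power of the periodic complex. -/
def Piece (n : ℕ) : Type := {w : Fin r → Cell p L // ∑ j, Cell.deg p L (w j) = n}

noncomputable instance [NeZero p] (n : ℕ) : Fintype (Piece p L r n) :=
  inferInstanceAs (Fintype {w : Fin r → Cell p L // ∑ j, Cell.deg p L (w j) = n})

instance (n : ℕ) : MulAction (Fin r → Multiplicative (ZMod p)) (Piece p L r n) where
  smul g w := ⟨fun j => Cell.act p L (g j) (w.1 j), by simpa only [Cell.deg_act] using w.2⟩
  one_smul w := by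
    refine Subtype.ext (funext fun j => ?_)
    change Cell.act p L 1 (w.1 j) = w.1 j
    obtain _ | ⟨a, c⟩ := w.1 j <;> simp [Cell.act]
  mul_smul g g' w := by
    refine Subtype.ext (funext fun j => ?_)
    change Cell.act p L (g j * g' j) (w.1 j) = Cell.act p L (g j) (Cell.act p L (g' j) (w.1 j))
    obtain _ | ⟨a, c⟩ := w.1 j <;> simp [Cell.act, add_assoc]

variable {p L r}

theorem Piece.smul_val {n : ℕ} (g : Fin r → Multiplicative (ZMod p)) (w : Piece p L r n) :
    (g • w).1 = fun j => Cell.act p L (g j) (w.1 j) := rfl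

theorem isProductSubgroup_stabilizer {n : ℕ} (w : Piece p L r n) :
    IsProductSubgroup p r (MulAction.stabilizer (Fin r → Multiplicative (ZMod p)) w) := by
  classical
  refine ⟨fun j => if w.1 j = none then ⊤ else ⊥, fun j => ?_, ?_⟩
  · by_cases h : w.1 j = none <;> simp [h]
  · ext g
    rw [MulAction.mem_stabilizer_iff, Subgroup.mem_pi]
    refine (Subtype.ext_iff.trans funext_iff).trans (forall_congr' fun j => ?_)
    rw [Piece.smul_val]
    rw [Cell.act_eq_self_iff]
    by_cases h : w.1 j = none <;> simp [h]

theorem eq_one_of_smul_eq {n : ℕ} (hn : n < L) (g : Fin r → Multiplicative (ZMod p))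
    (w : Piece p L r n) (h : g • w = w) : g = 1 := by
  funext j
  have hj := congrFun (congrArg Subtype.val h) j
  rw [Piece.smul_val, Cell.act_eq_self_iff] at hj
  refine hj.resolve_left fun e => ?_
  have := Finset.single_le_sum (f := fun j => Cell.deg p L (w.1 j)) (fun _ _ => Nat.zero_le _)
    (Finset.mem_univ j)
  rw [w.2] at this
  simp only [e, Cell.deg] at this
  omega

theorem isEmpty_piece {n : ℕ} (hn : r * L < n) : IsEmpty (Piece p L r n) := by
  refine ⟨fun w => ?_⟩
  have : ∑ j, Cell.deg p L (w.1 j) ≤ Fintype.card (Fin r) • L := by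
    refine Finset.sum_le_card_nsmul _ _ _ fun j _ => ?_
    obtain _ | ⟨a, c⟩ := w.1 j
    · exact le_rfl
    · exact a.2.le
  rw [w.2, Fintype.card_fin, smul_eq_mul] at this
  omega

variable {k : Type} [Field k]

/-- Restriction of a function to the basis elements of degree `n`. -/
def restrictPiece (n : ℕ) (F : (Fin r → Cell p L) → k) : Piece p L r n → k := fun w => F w.1

/-- Extension by zero of a function on the basis elements of degree `n`. -/
def extendPiece {n : ℕ} (f : Piece p L r n → k) : (Fin r → Cell p L) → k :=
  fun w => if h : ∑ j, Cell.deg p L (w j) = n then f ⟨w, h⟩ else 0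

theorem restrict_extend {n : ℕ} (f : Piece p L r n → k) :
    restrictPiece n (extendPiece f) = f := by
  funext w
  exact dif_pos w.2

theorem restrict_extend_of_ne {n i : ℕ} (hi : i ≠ n) (f : Piece p L r n → k) :
    restrictPiece i (extendPiece f) = 0 := by
  funext w
  exact dif_neg (w.2.symm ▸ hi)

variable [NeZero p]

theorem sum_piece (n : ℕ) (F : (Fin r → Cell p L) → k)
    (hF : ∀ w, F w ≠ 0 → ∑ j, Cell.deg p L (w j) = n) :
    ∑ w : Piece p L r n, F w.1 = ∑ w, F w := by
  classical
  refine Eq.trans ?_ (Finset.sum_filter_of_ne fun w _ => hF w)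
  exact (Finset.sum_subtype _ (by simp) F).symm

/-- The differential of the tensor power of the periodic complex in degree `n`. -/
noncomputable def pieceD (d : Matrix (Fin r → Cell p L) (Fin r → Cell p L) k) (n : ℕ) :
    (Piece p L r (n + 1) → k) →ₗ[k] (Piece p L r n → k) :=
  (d.submatrix (fun w : Piece p L r n => w.1) fun w : Piece p L r (n + 1) => w.1).mulVecLin

theorem pieceD_apply (d : Matrix (Fin r → Cell p L) (Fin r → Cell p L) k) (n : ℕ)
    (f : Piece p L r (n + 1) → k) (w : Piece p L r n) :
    pieceD d n f w = ∑ w' : Piece p L r (n + 1), d w.1 w'.1 * f w' := rfl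

/-- The augmentation of the tensor power of the periodic complex. -/
noncomputable def pieceAug : (Piece p L r 0 → k) →ₗ[k] k := ∑ w, LinearMap.proj w

theorem pieceAug_apply (f : Piece p L r 0 → k) : pieceAug f = ∑ w, f w := by
  simp [pieceAug]

/-- The augmentation as an intertwining map. -/
noncomputable def pieceAugIntertwining :
    (functionRep k (Fin r → Multiplicative (ZMod p)) (Piece p L r 0)).IntertwiningMap
      (Representation.trivial k (G := Fin r → Multiplicative (ZMod p)) (V := k)) :=
  ⟨pieceAug, fun g => by
    refine LinearMap.ext fun f => ?_
    rw [LinearMap.comp_apply, LinearMap.comp_apply, pieceAug_apply, Representation.trivial_apply,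
      pieceAug_apply]
    exact Fintype.sum_equiv (MulAction.toPerm g⁻¹) _ _ fun w' => rfl⟩

theorem proj_mulVec (b : Fin r → Cell p L) (F : (Fin r → Cell p L) → k) (w : Fin r → Cell p L) :
    (basepointProj k (fun w => ∑ j, Cell.deg p L (w j)) b *ᵥ F) w =
      if w = b then pieceAug (restrictPiece 0 F) else 0 := by
  split_ifs with hw
  · rw [pieceAug_apply]
    refine Eq.trans ?_ (sum_piece 0 (fun w' => basepointProj k
      (fun w => ∑ j, Cell.deg p L (w j)) b w w' * F w') fun w' h => ?_).symm |>.trans ?_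
    · rfl
    · exact (basepointProj_ne_zero (left_ne_zero_of_mul h)).2
    · refine Finset.sum_congr rfl fun w' _ => ?_
      rw [basepointProj, Matrix.of_apply, if_pos ⟨hw, w'.2⟩, one_mul]
      rfl
  · refine Finset.sum_eq_zero fun w' _ => ?_
    change basepointProj k _ b w w' * F w' = 0
    rw [basepointProj, Matrix.of_apply, if_neg fun e => hw e.1, zero_mul]

variable {b : Fin r → Cell p L} {d h : Matrix (Fin r → Cell p L) (Fin r → Cell p L) k}
  (H : IsContractedComplex (fun (g : Fin r → Multiplicative (ZMod p)) w j =>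
    Cell.act p L (g j) (w j)) (fun w => ∑ j, Cell.deg p L (w j)) b d h)

include H

theorem pieceD_restrict (n : ℕ) (F : (Fin r → Cell p L) → k) :
    pieceD d n (restrictPiece (n + 1) F) = restrictPiece n (d *ᵥ F) := by
  funext w
  refine (pieceD_apply _ _ _ _).trans (sum_piece (n + 1) (fun w' => d w.1 w' * F w') fun w' h => ?_)
  rw [H.d_deg _ _ (left_ne_zero_of_mul h), w.2]

theorem pieceD_comp (n : ℕ) (f : Piece p L r (n + 2) → k) :
    pieceD d n (pieceD d (n + 1) f) = 0 := by
  rw [← restrict_extend f, pieceD_restrict H, pieceD_restrict H, Matrix.mulVec_mulVec, H.d_mul_d,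
    Matrix.zero_mulVec]
  rfl

theorem pieceAug_comp (f : Piece p L r 1 → k) : pieceAug (pieceD d 0 f) = 0 := by
  have := proj_mulVec b (d *ᵥ extendPiece f) b
  rw [Matrix.mulVec_mulVec, H.proj_mul_d, Matrix.zero_mulVec, if_pos rfl,
    ← pieceD_restrict H, restrict_extend] at this
  exact this.symm

theorem eq_pieceD_of_mulVec_eq_zero {n : ℕ} (f : Piece p L r n → k)
    (hd : d *ᵥ extendPiece f = 0)
    (hε : pieceAug (restrictPiece 0 (extendPiece f)) = 0) :
    ∃ f', pieceD d n f' = f := by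
  refine ⟨restrictPiece (n + 1) (h *ᵥ extendPiece f), ?_⟩
  have := congrArg (· *ᵥ extendPiece f) H.homotopy
  have hp : basepointProj k (fun w => ∑ j, Cell.deg p L (w j)) b *ᵥ extendPiece f = 0 := by
    funext w
    rw [proj_mulVec, hε]
    simp
  simp only [Matrix.add_mulVec, Matrix.sub_mulVec, ← Matrix.mulVec_mulVec, hd, hp,
    Matrix.mulVec_zero, add_zero, sub_zero, Matrix.one_mulVec] at this
  rw [pieceD_restrict H, this, restrict_extend]

theorem mulVec_extend_eq_zero {n : ℕ} (f : Piece p L r n → k)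
    (hf : ∀ i (e : i + 1 = n), pieceD d i (e ▸ f) = 0) : d *ᵥ extendPiece f = 0 := by
  funext w
  have := congrFun (pieceD_restrict H _ (extendPiece f)) ⟨w, rfl⟩
  refine this.symm.trans ?_
  by_cases e : ∑ j, Cell.deg p L (w j) + 1 = n
  · subst e
    rw [restrict_extend]
    exact congrFun (hf _ rfl) _
  · rw [restrict_extend_of_ne e, map_zero]
    rfl

theorem exact_pieceD (n : ℕ) :
    Function.Exact (pieceD (k := k) (p := p) (L := L) (r := r) d (n + 1)) (pieceD d n) := by
  refine fun f => ⟨fun hf => ?_, ?_⟩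
  · refine eq_pieceD_of_mulVec_eq_zero H f (mulVec_extend_eq_zero H f fun i e => ?_) ?_
    · obtain rfl : i = n := Nat.succ_injective e
      exact hf
    · rw [restrict_extend_of_ne (by omega), map_zero]
  · rintro ⟨f, rfl⟩
    exact pieceD_comp H n f

theorem exact_pieceAug :
    Function.Exact (pieceD (k := k) (p := p) (L := L) (r := r) d 0) pieceAug := by
  refine fun f => ⟨fun hf => ?_, ?_⟩
  · refine eq_pieceD_of_mulVec_eq_zero H f (mulVec_extend_eq_zero H f fun i e => ?_) ?_
    · omega
    · rwa [restrict_extend]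
  · rintro ⟨f, rfl⟩
    exact pieceAug_comp H f

theorem surjective_pieceAug :
    Function.Surjective (pieceAug (k := k) (p := p) (L := L) (r := r)) := by
  classical
  let x : Piece p L r 0 := ⟨b, H.deg_base⟩
  refine fun c => ⟨fun w => if w = x then c else 0, ?_⟩
  simp [pieceAug_apply]

/-- The differential as an intertwining map. -/
noncomputable def pieceDIntertwining (n : ℕ) :
    (functionRep k (Fin r → Multiplicative (ZMod p)) (Piece p L r (n + 1))).IntertwiningMap
      (functionRep k (Fin r → Multiplicative (ZMod p)) (Piece p L r n)) :=
  ⟨pieceD d n, fun g => by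
    refine LinearMap.ext fun f => funext fun w => ?_
    rw [LinearMap.comp_apply, LinearMap.comp_apply, functionRep_apply, pieceD_apply, pieceD_apply]
    refine Fintype.sum_equiv (MulAction.toPerm g⁻¹) _ _ fun w' => ?_
    rw [functionRep_apply]
    exact congrArg (· * _) (H.d_act g⁻¹ w.1 w'.1).symm⟩

end Resolution

end ProductPermutationResolution

open ProductPermutationResolution

/-- For `E = (C_p)^r` and any `m ≥ 0`, the trivial module `k` has a finite resolution
`0 → P_n → ⋯ → P_0 → k → 0` by direct sums of permutation modules `k(E/H)` with `H`
product subgroups, which is free up to degree `m`. -/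
theorem trivial_module_has_product_permutation_resolution
    (p : ℕ) (hp : p.Prime) (k : Type) [Field k] [CharP k p] (r m : ℕ) :
    ∃ (n : ℕ)
      (P : ℕ → ModuleCat (MonoidAlgebra k (Fin r → Multiplicative (ZMod p))))
      (d : ∀ i, P (i + 1) ⟶ P i)
      (ε : P 0 ⟶ ModuleCat.of (MonoidAlgebra k (Fin r → Multiplicative (ZMod p)))
        ((Representation.trivial k (G := Fin r → Multiplicative (ZMod p))
          (V := k)).asModule)),
      (∀ i, IsProductPermutationModule p r k (P i)) ∧
      (∀ i ≤ m, Module.Free (MonoidAlgebra k (Fin r → Multiplicative (ZMod p))) (P i)) ∧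
      (∀ i, n < i → Subsingleton (P i)) ∧
      Function.Surjective ε ∧
      Function.Exact (d 0) ε ∧
      ∀ i, Function.Exact (d (i + 1)) (d i) := by
  have : Fact p.Prime := ⟨hp⟩
  let L := 2 * (m + 1)
  have hL0 : 0 < L := by omega
  let E := Fin r → Multiplicative (ZMod p)
  obtain ⟨d, h, H⟩ := (isContractedComplex_cell k p L (even_two_mul _) hL0).exists_pi r
  refine ⟨r * L,
    fun n => ModuleCat.of (MonoidAlgebra k E) (functionRep k E (Piece p L r n)).asModule,
    fun n => ModuleCat.ofHom
      (Representation.IntertwiningMap.equivLinearMapAsModule _ _ (pieceDIntertwining H n)),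
    ModuleCat.ofHom
      (Representation.IntertwiningMap.equivLinearMapAsModule _ _
        (pieceAugIntertwining (k := k) (p := p) (L := L) (r := r))),
    fun n => ?_, fun n hn => ?_, fun n hn => ?_, surjective_pieceAug (k := k) H,
    exact_pieceAug (k := k) H, exact_pieceD H⟩
  · obtain ⟨s, x, e⟩ := exists_equiv_directSum_quotient (k := k) (G := E) (X := Piece p L r n)
    exact ⟨s, fun i => MulAction.stabilizer E (x i), fun i => isProductSubgroup_stabilizer _, e⟩
  · exact free_functionRep fun g w => eq_one_of_smul_eq (by omega) g w
  · have := isEmpty_piece (p := p) hn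
    exact inferInstanceAs (Subsingleton (Piece p L r n → k))
end

section
/- Let G be a finite p-group and k a field of characteristic p > 0. Then for every finite-dimensional kG-module M there exists a finite-dimensional kG-module N such that M ⊕ N admits good permutation resolutions; in particular, for every integer m ≥ 0 the module M ⊕ N has a finite permutation resolution that is free up to degree m. -/
open CategoryTheory

def IsPermutationModule (k G : Type) [Field k] [Group G]
    (P : Type) [AddCommGroup P] [Module (MonoidAlgebra k G) P] : Prop :=
  ∃ (X : Type) (_ : Fintype X) (m : MulAction G X),
    Nonempty (P ≃ₗ[MonoidAlgebra k G] (@Representation.ofMulAction k _ G _ X m).asModule)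

def HasPermResFreeUpTo (k G : Type) [Field k] [Group G] (m : ℕ)
    (M : Type) [AddCommGroup M] [Module (MonoidAlgebra k G) M] : Prop :=
  ∃ (n : ℕ) (P : ℕ → ModuleCat (MonoidAlgebra k G))
    (d : ∀ i, P (i + 1) ⟶ P i) (ε : P 0 ⟶ ModuleCat.of (MonoidAlgebra k G) M),
    (∀ i, IsPermutationModule k G (P i)) ∧
    (∀ i ≤ m, Module.Free (MonoidAlgebra k G) (P i)) ∧
    (∀ i, n < i → Subsingleton (P i)) ∧
    Function.Surjective ε ∧
    Function.Exact (d 0) ε ∧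
    ∀ i, Function.Exact (d (i + 1)) (d i)

def HasFinitePermRes (k G : Type) [Field k] [Group G]
    (M : Type) [AddCommGroup M] [Module (MonoidAlgebra k G) M] : Prop :=
  ∃ (n : ℕ) (P : ℕ → ModuleCat (MonoidAlgebra k G))
    (d : ∀ i, P (i + 1) ⟶ P i) (ε : P 0 ⟶ ModuleCat.of (MonoidAlgebra k G) M),
    (∀ i, IsPermutationModule k G (P i)) ∧
    (∀ i, n < i → Subsingleton (P i)) ∧
    Function.Surjective ε ∧
    Function.Exact (d 0) ε ∧
    ∀ i, Function.Exact (d (i + 1)) (d i)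

def HasGoodPermRes (k G : Type) [Field k] [Group G]
    (M : Type) [AddCommGroup M] [Module (MonoidAlgebra k G) M] : Prop :=
  ∀ m : ℕ, HasPermResFreeUpTo k G m M

theorem exists_seq_of_step {α : ℕ → Type*} (r : ∀ i, α i → α (i + 1) → Prop) (a₀ : α 0)
    (step : ∀ i (a : α i), ∃ b, r i a b) :
    ∃ a : ∀ i, α i, a 0 = a₀ ∧ ∀ i, r i (a i) (a (i + 1)) := by
  choose next hnext using step
  exact ⟨fun i => Nat.rec a₀ (fun i a => next i a) i, rfl, fun i => hnext i _⟩

theorem LinearMap.exists_lift_of_range_le {R Q P P' : Type*} [Ring R] [AddCommGroup Q]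
    [AddCommGroup P] [AddCommGroup P'] [Module R Q] [Module R P] [Module R P']
    (hQ : Module.Projective R Q ∨ Subsingleton P') (d : P' →ₗ[R] P) (φ : Q →ₗ[R] P)
    (h : ∀ x, φ x ∈ LinearMap.range d) : ∃ ψ : Q →ₗ[R] P', ∀ x, d (ψ x) = φ x := by
  rcases hQ with hQ | hQ
  · obtain ⟨ψ, hψ⟩ := Module.projective_lifting_property d.rangeRestrict
      (φ.codRestrict (LinearMap.range d) h) d.surjective_rangeRestrict
    refine ⟨ψ, fun x => ?_⟩
    have := congrArg Subtype.val (LinearMap.congr_fun hψ x)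
    simpa using this
  · refine ⟨0, fun x => ?_⟩
    obtain ⟨y, hy⟩ := h x
    rw [← hy]
    congr 1
    exact Subsingleton.elim _ _

/-- The horseshoe lemma, where the resolution `Q` of `C` is projective in the degrees in which
the resolution `P` of `A` does not vanish. -/
theorem exists_horseshoe {R : Type*} [Ring R] {A B C : Type*} [AddCommGroup A] [AddCommGroup B]
    [AddCommGroup C] [Module R A] [Module R B] [Module R C]
    {P Q : ℕ → Type*} [∀ i, AddCommGroup (P i)] [∀ i, AddCommGroup (Q i)]
    [∀ i, Module R (P i)] [∀ i, Module R (Q i)]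
    (dP : ∀ i, P (i + 1) →ₗ[R] P i) (εP : P 0 →ₗ[R] A)
    (dQ : ∀ i, Q (i + 1) →ₗ[R] Q i) (εQ : Q 0 →ₗ[R] C)
    (hεP : Function.Surjective εP) (hP₀ : Function.Exact (dP 0) εP)
    (hP : ∀ i, Function.Exact (dP (i + 1)) (dP i))
    (hεQ : Function.Surjective εQ) (hQ₀ : Function.Exact (dQ 0) εQ)
    (hQ : ∀ i, Function.Exact (dQ (i + 1)) (dQ i))
    (ι : A →ₗ[R] B) (π : B →ₗ[R] C) (hι : Function.Injective ι) (hπ : Function.Surjective π)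
    (hex : Function.Exact ι π)
    (proj₀ : Module.Projective R (Q 0)) (proj₁ : Module.Projective R (Q 1))
    (proj : ∀ i, Module.Projective R (Q (i + 2)) ∨ Subsingleton (P (i + 1))) :
    ∃ (D : ∀ i, (P (i + 1) × Q (i + 1)) →ₗ[R] (P i × Q i)) (E : (P 0 × Q 0) →ₗ[R] B),
      Function.Surjective E ∧ Function.Exact (D 0) E ∧
        ∀ i, Function.Exact (D (i + 1)) (D i) := by
  obtain ⟨l, hl⟩ := Module.projective_lifting_property π εQ hπ
  replace hl : ∀ x, π (l x) = εQ x := fun x => LinearMap.congr_fun hl x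
  obtain ⟨f₀, hf₀⟩ := LinearMap.exists_lift_of_range_le (Or.inl proj₁) (ι ∘ₗ εP)
    (-(l ∘ₗ dQ 0)) (fun x => by
      have h1 : π ((-(l ∘ₗ dQ 0)) x) = 0 := by
        simp [hl, hQ₀.apply_apply_eq_zero]
      obtain ⟨a, ha⟩ := (hex _).1 h1
      obtain ⟨p, rfl⟩ := hεP a
      exact ⟨p, ha⟩)
  have hf₀' : ∀ x, f₀ (dQ 1 x) ∈ LinearMap.range (dP 0) := fun x => by
    refine (hP₀ _).1 (hι ?_)
    have := hf₀ (dQ 1 x)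
    simp only [LinearMap.comp_apply, LinearMap.neg_apply, (hQ 0).apply_apply_eq_zero,
      map_zero, neg_zero] at this
    rw [this, map_zero]
  obtain ⟨F, hF0, hF⟩ := exists_seq_of_step
    (α := fun i => {f : Q (i + 1) →ₗ[R] P i // ∀ x, f (dQ (i + 1) x) ∈ LinearMap.range (dP i)})
    (fun i f g => ∀ x, dP i (g.1 x) = -f.1 (dQ (i + 1) x)) ⟨f₀, hf₀'⟩ (fun i f => by
      obtain ⟨g, hg⟩ := LinearMap.exists_lift_of_range_le (proj i) (dP i)
        (-(f.1 ∘ₗ dQ (i + 1))) (fun x => by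
          simpa using f.2 x)
      refine ⟨⟨g, fun x => (hP i _).1 ?_⟩, fun x => by simpa using hg x⟩
      rw [hg]
      simp [(hQ (i + 1)).apply_apply_eq_zero])
  refine ⟨fun i => LinearMap.prod (dP i ∘ₗ LinearMap.fst R _ _ + (F i).1 ∘ₗ LinearMap.snd R _ _)
    (dQ i ∘ₗ LinearMap.snd R _ _), (ι ∘ₗ εP).coprod l, ?_, ?_, ?_⟩
  · intro b
    obtain ⟨q, hq⟩ := hεQ (π b)
    obtain ⟨a, ha⟩ := (hex (b - l q)).1 (by simp [hl, hq])
    obtain ⟨p, rfl⟩ := hεP a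
    exact ⟨(p, q), by simp [ha]⟩
  · rintro ⟨p, q⟩
    constructor
    · intro h
      have h' : ι (εP p) + l q = 0 := by simpa using h
      have h1 : εQ q = 0 := by
        have := congrArg π h'
        simpa [hl, hex.apply_apply_eq_zero] using this
      obtain ⟨q, rfl⟩ := (hQ₀ q).1 h1
      have h2 : εP (p - f₀ q) = 0 := hι (by
        have := hf₀ q
        simp only [LinearMap.comp_apply, LinearMap.neg_apply] at this
        rw [map_sub, map_sub, this, map_zero, sub_neg_eq_add, h'])
      obtain ⟨p', hp'⟩ := (hP₀ _).1 h2
      exact ⟨(p', q), by simp [hF0, hp']⟩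
    · rintro ⟨⟨p', q'⟩, h⟩
      simp only [LinearMap.prod_apply, Function.prod, LinearMap.add_apply, LinearMap.comp_apply,
        LinearMap.fst_apply, LinearMap.snd_apply, Prod.mk.injEq] at h
      obtain ⟨rfl, rfl⟩ := h
      have := hf₀ q'
      simp only [LinearMap.comp_apply, LinearMap.neg_apply] at this
      simp [hF0, hP₀.apply_apply_eq_zero, this]
  · rintro i ⟨p, q⟩
    constructor
    · intro h
      simp only [LinearMap.prod_apply, Function.prod, LinearMap.add_apply, LinearMap.comp_apply,
        LinearMap.fst_apply, LinearMap.snd_apply, Prod.mk_eq_zero] at h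
      obtain ⟨h1, h2⟩ := h
      obtain ⟨q, rfl⟩ := (hQ i q).1 h2
      have h3 : dP i (p - (F (i + 1)).1 q) = 0 := by
        rw [map_sub, hF, sub_neg_eq_add, h1]
      obtain ⟨p', hp'⟩ := (hP i _).1 h3
      exact ⟨(p', q), by simp [hp']⟩
    · rintro ⟨⟨p', q'⟩, h⟩
      simp only [LinearMap.prod_apply, Function.prod, LinearMap.add_apply, LinearMap.comp_apply,
        LinearMap.fst_apply, LinearMap.snd_apply, Prod.mk.injEq] at h
      obtain ⟨rfl, rfl⟩ := h
      simp [(hP i).apply_apply_eq_zero, (hQ i).apply_apply_eq_zero, hF]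

/-- An additive map commuting with the action of the monomials is `k[G]`-linear. -/
def AddMonoidHom.toMonoidAlgebraLinearMap {k G M N : Type*} [Semiring k] [Monoid G]
    [AddCommMonoid M] [AddCommMonoid N] [Module (MonoidAlgebra k G) M]
    [Module (MonoidAlgebra k G) N] (f : M →+ N)
    (h : ∀ (g : G) (r : k) x,
      f (MonoidAlgebra.single g r • x) = MonoidAlgebra.single g r • f x) :
    M →ₗ[MonoidAlgebra k G] N where
  __ := f
  map_smul' a x := by
    change f (a • x) = a • f x
    induction a using MonoidAlgebra.induction_linear with
    | zero => simp
    | add a b ha hb =>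
      rw [add_smul, add_smul, map_add, ha, hb]
    | single g r => exact h g r x

/-- A `k`-linear map of representations which commutes with the group action. -/
noncomputable def Representation.asModuleMap {k G V W : Type*} [CommSemiring k] [Monoid G]
    [AddCommMonoid V] [AddCommMonoid W] [Module k V] [Module k W] (ρ : Representation k G V)
    (τ : Representation k G W) (f : V →ₗ[k] W) (h : ∀ g x, f (ρ g x) = τ g (f x)) :
    ρ.asModule →ₗ[MonoidAlgebra k G] τ.asModule :=
  AddMonoidHom.toMonoidAlgebraLinearMap
    ((τ.asModuleEquiv.symm.toLinearMap ∘ₗ f ∘ₗ ρ.asModuleEquiv.toLinearMap).toAddMonoidHom)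
    (fun g r x => by
      rw [Representation.single_smul, Representation.single_smul]
      change f (r • _) = r • τ g (f _)
      rw [map_smul, h]; rfl)

/-- A `k`-linear equivalence of representations which commutes with the group action. -/
noncomputable def Representation.asModuleCongr {k G V W : Type*} [CommSemiring k] [Monoid G]
    [AddCommMonoid V] [AddCommMonoid W] [Module k V] [Module k W] (ρ : Representation k G V)
    (τ : Representation k G W) (f : V ≃ₗ[k] W) (h : ∀ g x, f (ρ g x) = τ g (f x)) :
    ρ.asModule ≃ₗ[MonoidAlgebra k G] τ.asModule where
  __ := Representation.asModuleMap ρ τ f.toLinearMap h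
  invFun := f.symm
  left_inv := f.left_inv
  right_inv := f.right_inv

/-- The action of `G` on the `k`-valued functions on a `G`-set. -/
def funRep (k G X : Type*) [CommSemiring k] [Group G] [MulAction G X] :
    Representation k G (X → k) where
  toFun g := LinearMap.funLeft k k (g⁻¹ • ·)
  map_one' := by ext; simp [LinearMap.funLeft_apply]
  map_mul' g h := by
    refine LinearMap.ext fun x => funext fun y => ?_
    simp [LinearMap.funLeft_apply, mul_smul]

@[simp]
theorem funRep_apply {k G X : Type*} [CommSemiring k] [Group G] [MulAction G X] (g : G)
    (x : X → k) (y : X) : funRep k G X g x y = x (g⁻¹ • y) := rfl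

/-- The linearization of a finite `G`-set is the module of functions on it. -/
noncomputable def ofMulActionEquivFunRep (k G X : Type*) [CommSemiring k] [Group G]
    [MulAction G X] [Finite X] :
    (Representation.ofMulAction k G X).asModule ≃ₗ[MonoidAlgebra k G] (funRep k G X).asModule :=
  Representation.asModuleCongr _ _
    ((MonoidAlgebra.coeffLinearEquiv k).trans (Finsupp.linearEquivFunOnFinite k k X))
    (fun g x => by
      ext y
      simp [Representation.coeff_ofMulAction])

theorem isPermutationModule_iff {k G P : Type} [Field k] [Group G] [AddCommGroup P]
    [Module (MonoidAlgebra k G) P] :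
    IsPermutationModule k G P ↔ ∃ (X : Type) (_ : Finite X) (_ : MulAction G X),
      Nonempty (P ≃ₗ[MonoidAlgebra k G] (funRep k G X).asModule) := by
  constructor
  · rintro ⟨X, _, m, ⟨e⟩⟩
    exact ⟨X, inferInstance, m, ⟨e.trans (ofMulActionEquivFunRep k G X)⟩⟩
  · rintro ⟨X, _, m, ⟨e⟩⟩
    exact ⟨X, Fintype.ofFinite X, m, ⟨e.trans (ofMulActionEquivFunRep k G X).symm⟩⟩

/-- Functions on a disjoint union of `G`-sets are pairs of functions. -/
noncomputable def funRepSumEquiv (k G X Y : Type*) [CommSemiring k] [Group G] [MulAction G X]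
    [MulAction G Y] : (funRep k G (X ⊕ Y)).asModule ≃ₗ[MonoidAlgebra k G]
      ((funRep k G X).prod (funRep k G Y)).asModule :=
  Representation.asModuleCongr _ _ (LinearEquiv.sumArrowLequivProdArrow X Y k k)
    (fun g x => by ext <;> rfl)

theorem IsPermutationModule.prod {k G P Q : Type} [Field k] [Group G] [AddCommGroup P]
    [Module (MonoidAlgebra k G) P] [AddCommGroup Q] [Module (MonoidAlgebra k G) Q]
    (hP : IsPermutationModule k G P) (hQ : IsPermutationModule k G Q) :
    IsPermutationModule k G (P × Q) := by
  rw [isPermutationModule_iff] at *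
  obtain ⟨X, _, _, ⟨e⟩⟩ := hP
  obtain ⟨Y, _, _, ⟨f⟩⟩ := hQ
  let u : ((funRep k G X).prod (funRep k G Y)).asModule ≃ₗ[MonoidAlgebra k G]
      ((funRep k G X).asModule × (funRep k G Y).asModule) :=
    { AddMonoidHom.toMonoidAlgebraLinearMap (k := k) (G := G)
        (M := ((funRep k G X).prod (funRep k G Y)).asModule)
        (N := (funRep k G X).asModule × (funRep k G Y).asModule)
        (AddMonoidHom.id ((X → k) × (Y → k))) (fun g r x => by
          rw [Representation.single_smul]
          refine Prod.ext ?_ ?_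
          · rw [Prod.smul_fst, Representation.single_smul]; rfl
          · rw [Prod.smul_snd, Representation.single_smul]; rfl) with
      invFun := fun x => x
      left_inv := fun _ => rfl
      right_inv := fun _ => rfl }
  exact ⟨X ⊕ Y, inferInstance, inferInstance,
    ⟨(LinearEquiv.prodCongr e f).trans (u.symm.trans (funRepSumEquiv k G X Y).symm)⟩⟩

/-- Good permutation resolutions extend to extensions. -/
theorem HasGoodPermRes.of_exact {k G : Type} [Field k] [Group G] {A B C : Type} [AddCommGroup A]
    [AddCommGroup B] [AddCommGroup C] [Module (MonoidAlgebra k G) A]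
    [Module (MonoidAlgebra k G) B] [Module (MonoidAlgebra k G) C]
    (ι : A →ₗ[MonoidAlgebra k G] B) (π : B →ₗ[MonoidAlgebra k G] C)
    (hι : Function.Injective ι) (hπ : Function.Surjective π) (hex : Function.Exact ι π)
    (hA : HasGoodPermRes k G A) (hC : HasGoodPermRes k G C) : HasGoodPermRes k G B := by
  intro m
  obtain ⟨nP, P, dP, εP, permP, freeP, zeroP, surjP, exP₀, exP⟩ := hA m
  obtain ⟨nQ, Q, dQ, εQ, permQ, freeQ, zeroQ, surjQ, exQ₀, exQ⟩ := hC (m + nP + 1)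
  have free (i : ℕ) (hi : i ≤ m + nP + 1) : Module.Projective (MonoidAlgebra k G) (Q i) :=
    have := freeQ i hi
    inferInstance
  obtain ⟨D, E, surjE, exE, exD⟩ := exists_horseshoe
    (P := fun i => P i) (Q := fun i => Q i) (fun i => (dP i).hom) εP.hom
    (fun i => (dQ i).hom) εQ.hom surjP exP₀ exP surjQ exQ₀ exQ ι π hι hπ hex
    (free 0 (by omega)) (free 1 (by omega)) (fun i => by
      rcases le_or_gt (i + 1) nP with h | h
      · exact Or.inl (free _ (by omega))
      · exact Or.inr (zeroP _ h))
  refine ⟨max nP nQ, fun i => ModuleCat.of _ (P i × Q i), fun i => ModuleCat.ofHom (D i),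
    ModuleCat.ofHom E, fun i => (permP i).prod (permQ i), fun i hi => ?_, fun i hi => ?_,
    surjE, exE, exD⟩
  · have := freeP i hi
    have := freeQ i (by omega)
    exact Module.Free.prod _ _ _
  · have := zeroP i (lt_of_le_of_lt (le_max_left _ _) hi)
    have := zeroQ i (lt_of_le_of_lt (le_max_right _ _) hi)
    exact inferInstanceAs (Subsingleton (P i × Q i))

theorem free_funRep_asModule {k G X : Type*} [CommRing k] [Group G] [Finite G] [MulAction G X]
    [Finite X] (hX : ∀ (g : G) (x : X), g • x = x → g = 1) :
    Module.Free (MonoidAlgebra k G) (funRep k G X).asModule := by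
  let Ω := MulAction.orbitRel.Quotient G X
  let c : (G → k) ≃ₗ[k] MonoidAlgebra k G :=
    (Finsupp.linearEquivFunOnFinite k k G).symm.trans (MonoidAlgebra.coeffLinearEquiv k).symm
  have hc (y : G → k) (g : G) : (c y).coeff g = y g := by simp [c]
  let f : (funRep k G X).asModule →+ (Ω → MonoidAlgebra k G) :=
    { toFun := fun x ω => c fun g => (funRep k G X).asModuleEquiv x (g • ω.out)
      map_zero' := by ext; simp [hc]
      map_add' := fun x y => by ext; simp [hc] }
  have hf (g : G) (r : k) (x) : f (MonoidAlgebra.single g r • x) =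
      MonoidAlgebra.single g r • f x := by
    funext ω
    ext h
    rw [Representation.single_smul, Pi.smul_apply, smul_eq_mul,
      MonoidAlgebra.coeff_single_mul_apply]
    change (c fun h => r * _).coeff h = _ * (c fun h => _).coeff _
    rw [hc, hc, mul_smul]
    rfl
  refine Module.Free.of_equiv (LinearEquiv.ofBijective
    (AddMonoidHom.toMonoidAlgebraLinearMap f hf) ⟨?_, ?_⟩).symm
  · refine (injective_iff_map_eq_zero f).2 fun x hx => ?_
    funext y
    have hy : y ∈ MulAction.orbit G (Quotient.mk'' y : Ω).out :=
      MulAction.orbitRel_apply.1 (Quotient.exact (Quotient.out_eq (Quotient.mk'' y : Ω)).symm)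
    obtain ⟨g, hg⟩ := hy
    have := congrArg (fun a => a.coeff g) (congrFun hx (Quotient.mk'' y : Ω))
    change (c fun g => _).coeff g = 0 at this
    rw [hc] at this
    simp only at hg
    rwa [hg] at this
  · intro z
    have hex (y : X) : ∃ g : G, g • (Quotient.mk'' y : Ω).out = y :=
      MulAction.orbitRel_apply.1 (Quotient.exact (Quotient.out_eq (Quotient.mk'' y : Ω)).symm)
    choose γ hγ using hex
    refine ⟨fun y => (z (Quotient.mk'' y)).coeff (γ y), ?_⟩
    funext ω
    ext g
    change (c fun g => _).coeff g = _
    rw [hc]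
    have hω : (Quotient.mk'' (g • ω.out) : Ω) = ω := by
      conv_rhs => rw [← Quotient.out_eq ω]
      exact Quotient.sound (MulAction.orbitRel_apply.2 (MulAction.mem_orbit _ _))
    have hg : γ (g • ω.out) = g := by
      have h := hγ (g • ω.out)
      rw [hω] at h
      have := hX (g⁻¹ * γ (g • ω.out)) ω.out (by rw [mul_smul, h, inv_smul_smul])
      rwa [inv_mul_eq_one, eq_comm] at this
    change (z (Quotient.mk'' (g • ω.out))).coeff (γ (g • ω.out)) = _
    rw [hg, hω]

theorem IsPGroup.exists_ne_zero_forall_apply_eq {p : ℕ} [Fact p.Prime] {G M : Type*} [Group G]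
    [Finite G] (hG : IsPGroup p G) [AddCommGroup M] [Module (ZMod p) M] [Nontrivial M]
    (ρ : Representation (ZMod p) G M) : ∃ v : M, v ≠ 0 ∧ ∀ g : G, ρ g v = v := by
  obtain ⟨w, hw⟩ := exists_ne (0 : M)
  let S : Submodule (ZMod p) M := Submodule.span (ZMod p) (Set.range fun g : G => ρ g w)
  have : Module.Finite (ZMod p) S := Module.Finite.span_of_finite _ (Set.finite_range _)
  have : Finite S := Module.finite_of_finite (ZMod p)
  have hS (g : G) : S ≤ S.comap (ρ g) := by
    refine Submodule.span_le.2 ?_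
    rintro _ ⟨h, rfl⟩
    exact Submodule.subset_span ⟨g * h, by simp⟩
  let _ : MulAction G S :=
    { smul := fun g x => ⟨ρ g x, hS g x.2⟩
      one_smul := fun x => Subtype.ext (by
        change ρ 1 x = x
        simp)
      mul_smul := fun g h x => Subtype.ext (by
        change ρ (g * h) x = ρ g (ρ h x)
        simp) }
  have hwS : w ∈ S := Submodule.subset_span ⟨1, by simp⟩
  have : Nontrivial S := ⟨⟨w, hwS⟩, 0, fun h => hw (congrArg Subtype.val h)⟩
  have hcard : p ∣ Nat.card S := by
    rw [Module.natCard_eq_pow_finrank (K := ZMod p), Nat.card_zmod]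
    exact dvd_pow_self p Module.finrank_pos.ne'
  obtain ⟨v, hv, hv0⟩ := hG.exists_fixed_point_of_prime_dvd_card_of_fixed_point S hcard
    (a := 0) (fun g => Subtype.ext (map_zero (ρ g)))
  exact ⟨v, fun h => hv0 (Subtype.ext h.symm), fun g => congrArg Subtype.val (hv g)⟩

theorem IsPGroup.exists_ne_zero_forall_single_smul_eq {p : ℕ} (hp : p.Prime) {k G M : Type*}
    [Field k] [CharP k p] [Group G] [Finite G] (hG : IsPGroup p G) [AddCommGroup M]
    [Module (MonoidAlgebra k G) M] [Nontrivial M] :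
    ∃ v : M, v ≠ 0 ∧ ∀ g : G, MonoidAlgebra.single g (1 : k) • v = v := by
  have : Fact p.Prime := ⟨hp⟩
  have hchar (x : M) : p • x = 0 := by
    have h : ((p : ℕ) : MonoidAlgebra k G) = 0 := by
      have := map_natCast (algebraMap k (MonoidAlgebra k G)) p
      rw [CharP.cast_eq_zero, map_zero] at this
      exact this.symm
    rw [← Nat.cast_smul_eq_nsmul (MonoidAlgebra k G), h, zero_smul]
  let _ : Module (ZMod p) M := AddCommGroup.zmodModule hchar
  exact hG.exists_ne_zero_forall_apply_eq (p := p) (M := M)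
    { toFun := fun g =>
        (DistribSMul.toAddMonoidHom M (MonoidAlgebra.single g (1 : k))).toZModLinearMap p
      map_one' := by
        ext x
        change MonoidAlgebra.single (1 : G) (1 : k) • x = x
        rw [← MonoidAlgebra.one_def, one_smul]
      map_mul' := fun g h => by
        ext x
        change MonoidAlgebra.single (g * h) (1 : k) • x =
          MonoidAlgebra.single g (1 : k) • MonoidAlgebra.single h (1 : k) • x
        rw [smul_smul, MonoidAlgebra.single_mul_single, mul_one] }

theorem HasGoodPermRes.of_subsingleton {k G M : Type} [Field k] [Group G] [AddCommGroup M]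
    [Module (MonoidAlgebra k G) M] [Subsingleton M] : HasGoodPermRes k G M := by
  intro m
  let act : MulAction G Empty :=
    { smul := fun _ x => x, one_smul := fun _ => rfl, mul_smul := fun _ _ _ => rfl }
  refine ⟨0, fun _ => ModuleCat.of _ PUnit, fun _ => ModuleCat.ofHom 0, ModuleCat.ofHom 0,
    fun _ => isPermutationModule_iff.2 ⟨Empty, inferInstance, act, ⟨?_⟩⟩,
    fun _ _ => inferInstanceAs (Module.Free (MonoidAlgebra k G) PUnit),
    fun _ _ => inferInstanceAs (Subsingleton PUnit), fun x => ⟨0, Subsingleton.elim _ _⟩,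
    fun x => ⟨fun _ => ⟨0, Subsingleton.elim (α := PUnit) _ _⟩, fun _ => Subsingleton.elim _ _⟩,
    fun _ x => ⟨fun _ => ⟨0, Subsingleton.elim (α := PUnit) _ _⟩,
      fun _ => Subsingleton.elim (α := PUnit) _ _⟩⟩
  exact { toFun := fun _ => 0, map_add' := fun _ _ => (add_zero _).symm,
          map_smul' := fun _ _ => (smul_zero _).symm, invFun := fun _ => 0,
          left_inv := fun _ => rfl, right_inv := fun _ => funext fun x => x.elim }

theorem HasGoodPermRes.of_trivial {p : ℕ} (hp : p.Prime) {k G : Type} [Field k] [CharP k p]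
    [Group G] [Finite G] (hG : IsPGroup p G)
    (htriv : HasGoodPermRes k G (Representation.trivial k G k).asModule) (M : Type)
    [AddCommGroup M] [Module (MonoidAlgebra k G) M] [Module.Finite (MonoidAlgebra k G) M] :
    HasGoodPermRes k G M := by
  have : IsNoetherianRing (MonoidAlgebra k G) := IsNoetherianRing.of_finite k _
  have key (N : Submodule (MonoidAlgebra k G) M) : HasGoodPermRes k G (M ⧸ N) := by
    induction N using WellFoundedGT.induction with
    | ind N ih =>
      rcases subsingleton_or_nontrivial (M ⧸ N) with h | h
      · exact .of_subsingleton
      · obtain ⟨v, hv0, hv⟩ := hG.exists_ne_zero_forall_single_smul_eq hp (k := k) (M := M ⧸ N)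
        let ι : (Representation.trivial k G k).asModule →ₗ[MonoidAlgebra k G] M ⧸ N :=
          AddMonoidHom.toMonoidAlgebraLinearMap
            { toFun := fun c => algebraMap k (MonoidAlgebra k G)
                ((Representation.trivial k G k).asModuleEquiv c) • v
              map_zero' := by simp
              map_add' := fun x y => by simp [add_smul] } (fun g r x => by
                rw [Representation.single_smul]
                change algebraMap k (MonoidAlgebra k G)
                  (r * (Representation.trivial k G k).asModuleEquiv x) • v =
                  MonoidAlgebra.single g r • algebraMap k (MonoidAlgebra k G)
                  ((Representation.trivial k G k).asModuleEquiv x) • v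
                conv_lhs => rw [← hv g]
                rw [smul_smul, smul_smul]
                congr 1
                simp [MonoidAlgebra.single_mul_single])
        have hι (c) : ι c = algebraMap k (MonoidAlgebra k G)
                ((Representation.trivial k G k).asModuleEquiv c) • v := rfl
        let N' := (LinearMap.range ι).comap N.mkQ
        have hNN' : N ≤ N' := fun x hx => by
          have : N.mkQ x = 0 := by simpa using hx
          simp [N', this]
        have hlt : N < N' := by
          refine lt_of_le_of_ne hNN' fun h => hv0 ?_
          obtain ⟨m, rfl⟩ := N.mkQ_surjective v
          have : m ∈ N' := ⟨(Representation.trivial k G k).asModuleEquiv.symm 1, by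
            rw [hι, LinearEquiv.apply_symm_apply, map_one, one_smul]⟩
          rw [← h] at this
          simpa using this
        refine .of_exact ι (Submodule.factor hNN') ?_ (Submodule.factor_surjective hNN') ?_
          htriv (ih N' hlt)
        · refine (injective_iff_map_eq_zero ι).2 fun c hc => by_contra fun hc0 => hv0 ?_
          have := congrArg (fun x => algebraMap k (MonoidAlgebra k G)
            ((Representation.trivial k G k).asModuleEquiv c)⁻¹ • x) hc
          simp only [hι, smul_smul, ← map_mul, smul_zero] at this
          rwa [inv_mul_cancel₀ hc0, map_one, one_smul] at this
        · intro x
          obtain ⟨m, rfl⟩ := N.mkQ_surjective x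
          simp [N']
  let e := Submodule.quotEquivOfEqBot (⊥ : Submodule (MonoidAlgebra k G) M) rfl
  exact .of_exact (C := PUnit) e.toLinearMap 0 e.injective
    (fun x => ⟨0, Subsingleton.elim _ _⟩)
    (fun x => ⟨fun _ => e.surjective x, fun _ => Subsingleton.elim _ _⟩) (key ⊥) .of_subsingleton

section TensorPower

set_option linter.unusedSectionVars false

variable {k I Y : Type*} [CommRing k] [Fintype I] [DecidableEq I] [Fintype Y] [DecidableEq Y]

/-- A system of signs on pairs of indices which is antisymmetric off the diagonal. -/
structure IsSignSystem (σ : I → I → k) : Prop where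
  diag : ∀ i, σ i i = 1
  sq : ∀ i j, σ i j * σ i j = 1
  antisymm : ∀ i j, i ≠ j → σ i j = -σ j i

/-- The Koszul sign of position `i` in the basis tensor `f`. -/
def koszulSign (σ : I → I → k) (deg : Y → ℕ) (i : I) (f : I → Y) : k :=
  ∏ j, σ j i ^ deg (f j)

/-- The operator on the tensor power of `Y → k` indexed by `I`, with basis `I → Y`, which applies
the matrix `a` at position `i`, with a Koszul sign. -/
def liftAt (σ : I → I → k) (deg : Y → ℕ) (a : Matrix Y Y k) (i : I) :
    ((I → Y) → k) →ₗ[k] ((I → Y) → k) where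
  toFun x f := koszulSign σ deg i f * ∑ w, a (f i) w * x (Function.update f i w)
  map_add' x y := by
    ext f
    simp [mul_add, Finset.sum_add_distrib]
  map_smul' c x := by
    ext f
    simp only [Pi.smul_apply, smul_eq_mul, RingHom.id_apply, Finset.mul_sum]
    exact Finset.sum_congr rfl fun w _ => by ring

theorem liftAt_apply (σ : I → I → k) (deg : Y → ℕ) (a : Matrix Y Y k) (i : I)
    (x : (I → Y) → k) (f : I → Y) : liftAt σ deg a i x f =
      koszulSign σ deg i f * ∑ w, a (f i) w * x (Function.update f i w) := rfl

theorem IsSignSystem.koszulSign_mul_self {σ : I → I → k} (hσ : IsSignSystem σ) (deg : Y → ℕ)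
    (i : I) (f : I → Y) : koszulSign σ deg i f * koszulSign σ deg i f = 1 := by
  simp [koszulSign, ← Finset.prod_mul_distrib, ← mul_pow, hσ.sq]

theorem koszulSign_update (σ : I → I → k) (deg : Y → ℕ)
    (i j : I) (f : I → Y) (w : Y) : koszulSign σ deg j (Function.update f i w) =
      σ i j ^ deg w * ∏ l ∈ Finset.univ.erase i, σ l j ^ deg (f l) := by
  rw [koszulSign, ← Finset.mul_prod_erase _ _ (Finset.mem_univ i), Function.update_self]
  congr 1
  refine Finset.prod_congr rfl fun l hl => ?_
  rw [Function.update_of_ne (Finset.ne_of_mem_erase hl)]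

theorem IsSignSystem.koszulSign_update_self {σ : I → I → k} (hσ : IsSignSystem σ) (deg : Y → ℕ)
    (i : I) (f : I → Y) (w : Y) :
    koszulSign σ deg i (Function.update f i w) = koszulSign σ deg i f := by
  conv_rhs => rw [← Function.update_eq_self i f]
  rw [koszulSign_update, koszulSign_update, hσ.diag, one_pow, one_pow]

theorem IsSignSystem.koszulSign_update_of_odd {σ : I → I → k} (hσ : IsSignSystem σ) {deg : Y → ℕ}
    (i j : I) (f : I → Y) {w : Y} (hw : Odd (deg (f i) + deg w)) :
    koszulSign σ deg j (Function.update f i w) = σ i j * koszulSign σ deg j f := by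
  conv_rhs => rw [← Function.update_eq_self i f]
  rw [koszulSign_update, koszulSign_update, ← mul_assoc]
  congr 1
  have heven {n : ℕ} (hn : Even n) : σ i j ^ n = 1 := by
    obtain ⟨m, rfl⟩ := hn
    rw [pow_add, ← mul_pow, hσ.sq, one_pow]
  have hodd {n : ℕ} (hn : Odd n) : σ i j ^ n = σ i j := by
    obtain ⟨m, rfl⟩ := hn
    rw [pow_succ, heven (even_two_mul m), one_mul]
  rcases Nat.even_or_odd (deg w) with h | h
  · have h' : Odd (deg (f i)) := by
      rw [Nat.odd_add] at hw
      exact hw.2 h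
    rw [heven h, hodd h', hσ.sq]
  · have h' : Even (deg (f i)) := by
      rw [Nat.odd_add'] at hw
      exact hw.1 h
    rw [hodd h, heven h', mul_one]

theorem IsSignSystem.liftAt_liftAt_self {σ : I → I → k} (hσ : IsSignSystem σ) (deg : Y → ℕ)
    (a b : Matrix Y Y k) (i : I) (x : (I → Y) → k) (f : I → Y) :
    liftAt σ deg a i (liftAt σ deg b i x) f =
      ∑ v, (a * b) (f i) v * x (Function.update f i v) := by
  simp only [liftAt_apply, hσ.koszulSign_update_self, Function.update_self,
    Function.update_idem, Matrix.mul_apply, Finset.mul_sum, Finset.sum_mul]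
  rw [Finset.sum_comm]
  refine Finset.sum_congr rfl fun v _ => Finset.sum_congr rfl fun w _ => ?_
  linear_combination (a (f i) w * b w v * x (Function.update f i v)) *
    hσ.koszulSign_mul_self deg i f

theorem IsSignSystem.liftAt_liftAt_of_ne {σ : I → I → k} (hσ : IsSignSystem σ) {deg : Y → ℕ}
    {a : Matrix Y Y k} (ha : ∀ y w, a y w ≠ 0 → Odd (deg y + deg w)) (b : Matrix Y Y k) {i j : I}
    (hij : i ≠ j) (x : (I → Y) → k) (f : I → Y) :
    liftAt σ deg a i (liftAt σ deg b j x) f =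
      koszulSign σ deg i f * koszulSign σ deg j f * σ i j * ∑ w, ∑ v,
        a (f i) w * b (f j) v * x (Function.update (Function.update f i w) j v) := by
  simp only [liftAt_apply, Finset.mul_sum, Function.update_of_ne hij.symm]
  refine Finset.sum_congr rfl fun w _ => Finset.sum_congr rfl fun v _ => ?_
  by_cases h : a (f i) w = 0
  · simp [h]
  · rw [hσ.koszulSign_update_of_odd i j f (ha _ _ h)]
    ring

theorem IsSignSystem.liftAt_anticomm {σ : I → I → k} (hσ : IsSignSystem σ) {deg : Y → ℕ}
    {a b : Matrix Y Y k} (ha : ∀ y w, a y w ≠ 0 → Odd (deg y + deg w))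
    (hb : ∀ y w, b y w ≠ 0 → Odd (deg y + deg w)) {i j : I}
    (hij : i ≠ j) (x : (I → Y) → k) :
    liftAt σ deg a i (liftAt σ deg b j x) + liftAt σ deg b j (liftAt σ deg a i x) = 0 := by
  ext f
  rw [Pi.add_apply, hσ.liftAt_liftAt_of_ne ha b hij, hσ.liftAt_liftAt_of_ne hb a hij.symm,
    Finset.sum_comm, hσ.antisymm i j hij, Pi.zero_apply]
  have : ∀ v w, a (f i) w * b (f j) v * x (Function.update (Function.update f i w) j v) =
      b (f j) v * a (f i) w * x (Function.update (Function.update f j v) i w) := fun v w => by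
    rw [Function.update_comm hij, mul_comm (a _ _)]
  simp only [this]
  ring

/-- The differential of the tensor power of the complex with differential `a`. -/
def tensorDiff (σ : I → I → k) (deg : Y → ℕ) (a : Matrix Y Y k) :
    ((I → Y) → k) →ₗ[k] ((I → Y) → k) := ∑ i, liftAt σ deg a i

theorem tensorDiff_apply (σ : I → I → k) (deg : Y → ℕ) (a : Matrix Y Y k) (x : (I → Y) → k) :
    tensorDiff σ deg a x = ∑ i, liftAt σ deg a i x := by
  simp [tensorDiff]

theorem IsSignSystem.tensorDiff_tensorDiff {σ : I → I → k} (hσ : IsSignSystem σ) {deg : Y → ℕ}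
    {a : Matrix Y Y k} (ha : ∀ y w, a y w ≠ 0 → Odd (deg y + deg w)) (haa : a * a = 0)
    (x : (I → Y) → k) : tensorDiff σ deg a (tensorDiff σ deg a x) = 0 := by
  have hself (i : I) : liftAt σ deg a i (liftAt σ deg a i x) = 0 := by
    ext f
    simp [hσ.liftAt_liftAt_self, haa]
  simp only [tensorDiff_apply, map_sum]
  rw [← Finset.sum_product']
  refine Finset.sum_involution (fun q _ => q.swap) ?_ ?_ (by simp) (by simp)
  · rintro ⟨i, j⟩ -
    rcases eq_or_ne i j with rfl | h
    · simp [hself]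
    · exact hσ.liftAt_anticomm ha ha h.symm x
  · rintro ⟨i, j⟩ - h h'
    obtain rfl : j = i := congrArg Prod.fst h'
    exact h (hself _)

theorem IsSignSystem.tensorDiff_homotopy {σ : I → I → k} (hσ : IsSignSystem σ) {deg : Y → ℕ}
    {a b π : Matrix Y Y k} (ha : ∀ y w, a y w ≠ 0 → Odd (deg y + deg w))
    (hb : ∀ y w, b y w ≠ 0 → Odd (deg y + deg w)) (hab : a * b + b * a = 1 - π)
    (i : I) (x : (I → Y) → k) (f : I → Y) :
    tensorDiff σ deg a (liftAt σ deg b i x) f + liftAt σ deg b i (tensorDiff σ deg a x) f =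
      x f - ∑ v, π (f i) v * x (Function.update f i v) := by
  have h : tensorDiff σ deg a (liftAt σ deg b i x) + liftAt σ deg b i (tensorDiff σ deg a x) =
      liftAt σ deg a i (liftAt σ deg b i x) + liftAt σ deg b i (liftAt σ deg a i x) := by
    simp only [tensorDiff_apply, map_sum, ← Finset.sum_add_distrib]
    exact Finset.sum_eq_single i (fun j _ hj => hσ.liftAt_anticomm ha hb hj x) (by simp)
  rw [← Pi.add_apply, h, Pi.add_apply, hσ.liftAt_liftAt_self, hσ.liftAt_liftAt_self,
    ← Finset.sum_add_distrib]
  simp only [← add_mul, ← Matrix.add_apply, hab, Matrix.sub_apply, sub_mul,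
    Finset.sum_sub_distrib, Matrix.one_apply, ite_mul, one_mul, zero_mul, Finset.sum_ite_eq,
    Finset.mem_univ, if_true, Function.update_eq_self]

/-- The total degree of a basis tensor. -/
def totalDeg (deg : Y → ℕ) (f : I → Y) : ℕ := ∑ i, deg (f i)

theorem totalDeg_update (deg : Y → ℕ) (f : I → Y) (i : I) (w : Y) :
    totalDeg deg (Function.update f i w) + deg (f i) = totalDeg deg f + deg w := by
  simp only [totalDeg]
  rw [← Finset.add_sum_erase _ _ (Finset.mem_univ i),
    ← Finset.add_sum_erase _ (fun j => deg (f j)) (Finset.mem_univ i), Function.update_self,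
    Finset.sum_congr rfl fun l (hl : l ∈ Finset.univ.erase i) => by
      rw [Function.update_of_ne (Finset.ne_of_mem_erase hl)]]
  ring

theorem totalDeg_eq_zero_iff {deg : Y → ℕ} {f : I → Y} :
    totalDeg deg f = 0 ↔ ∀ i, deg (f i) = 0 := by
  simp [totalDeg]

/-- The augmentation of the tensor power of a complex augmented by the sum of the coefficients in
degree zero. -/
def tensorAug (k : Type*) [CommRing k] (deg : Y → ℕ) : ((I → Y) → k) →ₗ[k] k :=
  ∑ f with totalDeg deg f = 0, LinearMap.proj f

theorem tensorAug_apply (deg : Y → ℕ) (x : (I → Y) → k) :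
    tensorAug k deg x = ∑ f with totalDeg deg f = 0, x f := by
  simp [tensorAug]

theorem Fintype.sum_eq_zero_of_sum_update {M : Type*} [AddCommMonoid M] (i : I)
    (F : (I → Y) → M) (h : ∀ f, ∑ y, F (Function.update f i y) = 0) : ∑ f, F f = 0 := by
  rw [← (Equiv.funSplitAt i Y).symm.sum_comp F, Fintype.sum_prod_type_right]
  refine Finset.sum_eq_zero fun r _ => ?_
  rcases isEmpty_or_nonempty Y with hY | ⟨⟨y₀⟩⟩
  · simp
  rw [← h ((Equiv.funSplitAt i Y).symm (y₀, r))]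
  refine Finset.sum_congr rfl fun y _ => congrArg F ?_
  ext j
  by_cases hj : j = i
  · subst hj; simp [Equiv.funSplitAt, Equiv.piSplitAt]
  · simp [Equiv.funSplitAt, Equiv.piSplitAt, hj]

theorem tensorAug_tensorDiff (σ : I → I → k) {deg : Y → ℕ} {a : Matrix Y Y k}
    (ha : ∀ w, ∑ y with deg y = 0, a y w = 0) (x : (I → Y) → k) :
    tensorAug k deg (tensorDiff σ deg a x) = 0 := by
  rw [tensorDiff_apply, map_sum]
  refine Finset.sum_eq_zero fun i _ => ?_
  rw [tensorAug_apply, Finset.sum_filter]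
  refine Fintype.sum_eq_zero_of_sum_update i _ fun f => ?_
  by_cases hf : ∀ j, j ≠ i → deg (f j) = 0
  · have h1 (y : Y) : totalDeg deg (Function.update f i y) = 0 ↔ deg y = 0 := by
      rw [totalDeg_eq_zero_iff]
      refine ⟨fun h => by simpa using h i, fun h j => ?_⟩
      by_cases hj : j = i
      · subst hj; simpa using h
      · simpa [hj] using hf j hj
    simp only [h1, ← Finset.sum_filter]
    have h2 (y) (hy : y ∈ Finset.univ.filter (fun y => deg y = 0)) :
        liftAt σ deg a i x (Function.update f i y) =
          ∑ w, a y w * x (Function.update f i w) := by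
      have hy' := totalDeg_eq_zero_iff.1 ((h1 y).2 (Finset.mem_filter.1 hy).2)
      rw [liftAt_apply, koszulSign]
      simp only [hy', pow_zero, Finset.prod_const_one, one_mul, Function.update_self,
        Function.update_idem]
    rw [Finset.sum_congr rfl h2, Finset.sum_comm]
    refine Finset.sum_eq_zero fun w _ => ?_
    rw [← Finset.sum_mul, ha, zero_mul]
  · push Not at hf
    obtain ⟨j, hj, hj'⟩ := hf
    refine Finset.sum_eq_zero fun y _ => if_neg fun h => hj' ?_
    simpa [hj] using totalDeg_eq_zero_iff.1 h j

/-- The tensor power of a complex which is contractible to its degree zero augmentation is a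
resolution. -/
theorem IsSignSystem.exists_tensorDiff_eq {σ : I → I → k} (hσ : IsSignSystem σ) {deg : Y → ℕ}
    {a b : Matrix Y Y k} {y₀ : Y} (hy₀ : deg y₀ = 0)
    (ha : ∀ y w, a y w ≠ 0 → Odd (deg y + deg w))
    (hb : ∀ y w, b y w ≠ 0 → Odd (deg y + deg w)) (haa : a * a = 0)
    (ha₀ : ∀ w, ∑ y with deg y = 0, a y w = 0)
    (hab : a * b + b * a = 1 - Matrix.of fun y w => if y = y₀ ∧ deg w = 0 then 1 else 0)
    (x : (I → Y) → k) (hx : tensorDiff σ deg a x = 0) (hx₀ : tensorAug k deg x = 0) :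
    ∃ y, tensorDiff σ deg a y = x := by
  have key (J : Finset I) : ∃ y, ∀ f, (x - tensorDiff σ deg a y) f ≠ 0 → ∀ j ∈ J, f j = y₀ := by
    induction J using Finset.induction_on with
    | empty => simp
    | insert i J hi ih =>
      obtain ⟨y, hy⟩ := ih
      set z := x - tensorDiff σ deg a y with hz
      have hz0 : tensorDiff σ deg a z = 0 := by
        rw [hz, map_sub, hx, hσ.tensorDiff_tensorDiff ha haa, sub_zero]
      refine ⟨y + liftAt σ deg b i z, fun f hf => ?_⟩
      have h := hσ.tensorDiff_homotopy ha hb hab i z f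
      rw [hz0, map_zero, Pi.zero_apply, add_zero] at h
      have h' : (x - tensorDiff σ deg a (y + liftAt σ deg b i z)) f =
          ∑ v, (if f i = y₀ ∧ deg v = 0 then 1 else 0) * z (Function.update f i v) := by
        rw [map_add, ← sub_sub, ← hz, Pi.sub_apply, h]
        simp
      rw [h'] at hf
      obtain ⟨v, -, hv⟩ := Finset.exists_ne_zero_of_sum_ne_zero hf
      have h1 := left_ne_zero_of_mul hv
      have h2 := right_ne_zero_of_mul hv
      intro j hj
      rcases Finset.mem_insert.1 hj with rfl | hj
      · by_contra hc
        exact h1 (if_neg fun h => hc h.1)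
      · have hji : j ≠ i := fun h => hi (h ▸ hj)
        simpa [hji] using hy _ h2 j hj
  obtain ⟨y, hy⟩ := key Finset.univ
  refine ⟨y, (sub_eq_zero.1 ?_).symm⟩
  have h0 : tensorAug k deg (x - tensorDiff σ deg a y) = 0 := by
    rw [map_sub, hx₀, tensorAug_tensorDiff σ ha₀, sub_zero]
  have hne (f : I → Y) (hf : f ≠ fun _ => y₀) : (x - tensorDiff σ deg a y) f = 0 := by
    by_contra hc
    exact hf (funext fun j => hy f hc j (Finset.mem_univ j))
  rw [tensorAug_apply, Finset.sum_eq_single_of_mem (fun _ => y₀) (by simp [totalDeg, hy₀])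
    (fun f _ hf => hne f hf)] at h0
  ext f
  by_cases hf : f = fun _ => y₀
  · rw [hf, h0, Pi.zero_apply]
  · exact hne f hf

end TensorPower

section GradedResolution

variable {k G X : Type} [Field k] [Group G] [MulAction G X]

/-- The elements of a given degree of a graded `G`-set. -/
def levelSet (δ : X → ℕ) (hδ : ∀ (g : G) x, δ (g • x) = δ x) (n : ℕ) : SubMulAction G X where
  carrier := {x | δ x = n}
  smul_mem' g x hx := (hδ g x).trans hx

open Classical in
/-- Extension by zero of functions on a sub-`G`-set. -/
noncomputable def SubMulAction.extendZero (k : Type) [Field k] (S : SubMulAction G X) :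
    (S → k) →ₗ[k] (X → k) where
  toFun x f := if h : f ∈ S then x ⟨f, h⟩ else 0
  map_add' x y := by
    ext f
    by_cases h : f ∈ S <;> simp [h]
  map_smul' c x := by
    ext f
    by_cases h : f ∈ S <;> simp [h]

theorem SubMulAction.extendZero_of_mem {S : SubMulAction G X} (x : S → k) {f : X} (h : f ∈ S) :
    S.extendZero k x f = x ⟨f, h⟩ := dif_pos h

theorem SubMulAction.extendZero_of_notMem {S : SubMulAction G X} (x : S → k) {f : X}
    (h : f ∉ S) : S.extendZero k x f = 0 := dif_neg h

theorem SubMulAction.extendZero_funRep (S : SubMulAction G X) (g : G) (x : S → k) :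
    S.extendZero k (funRep k G S g x) = funRep k G X g (S.extendZero k x) := by
  ext f
  rw [funRep_apply]
  by_cases h : f ∈ S
  · rw [S.extendZero_of_mem _ h, S.extendZero_of_mem _ (S.smul_mem g⁻¹ h)]
    rfl
  · rw [S.extendZero_of_notMem _ h, S.extendZero_of_notMem _ fun hmem => h ?_]
    simpa using S.smul_mem g hmem

/-- An equivariant differential on the functions on a graded `G`-set which lowers degrees by one
and is exact away from an augmentation to `k` gives a permutation resolution of `k`. -/
theorem hasPermResFreeUpTo_trivial_of_graded [Finite G] [Finite X] (m : ℕ) (δ : X → ℕ)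
    (hδ : ∀ (g : G) x, δ (g • x) = δ x)
    (hfree : ∀ (g : G) x, δ x ≤ m → g • x = x → g = 1)
    (D : (X → k) →ₗ[k] (X → k)) (A : (X → k) →ₗ[k] k)
    (hDG : ∀ g x, D (funRep k G X g x) = funRep k G X g (D x))
    (hAG : ∀ g x, A (funRep k G X g x) = A x)
    (hD : ∀ x f, (∀ f', δ f' = δ f + 1 → x f' = 0) → D x f = 0)
    (hA : ∀ x, (∀ f, δ f = 0 → x f = 0) → A x = 0)
    (hDD : ∀ x, D (D x) = 0) (hAD : ∀ x, A (D x) = 0)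
    (hex : ∀ x, D x = 0 → A x = 0 → ∃ y, D y = x) (hsurj : ∃ x, A x = 1) :
    HasPermResFreeUpTo k G m (Representation.trivial k G k).asModule := by
  let S (n : ℕ) : SubMulAction G X := levelSet δ hδ n
  let E (n : ℕ) : (S n → k) →ₗ[k] (X → k) := (S n).extendZero k
  let R (n : ℕ) : (X → k) →ₗ[k] (S n → k) := LinearMap.funLeft k k Subtype.val
  have hE (n : ℕ) (x) (f : X) (h : δ f ≠ n) : E n x f = 0 :=
    SubMulAction.extendZero_of_notMem x h
  have hER (n : ℕ) (x : X → k) (f : X) (h : δ f = n) : E n (R n x) f = x f :=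
    SubMulAction.extendZero_of_mem (S := S n) (R n x) h
  have hRE (n : ℕ) (x : S n → k) : R n (E n x) = x :=
    funext fun f => SubMulAction.extendZero_of_mem x f.2
  have hdE (n : ℕ) (x) : E n (R n (D (E (n + 1) x))) = D (E (n + 1) x) := by
    ext f
    by_cases h : δ f = n
    · exact hER n _ f h
    · rw [hE n _ f h, hD]
      exact fun f' hf' => hE _ _ _ (by omega)
  have hDR (n : ℕ) (y : X → k) : R n (D (E (n + 1) (R (n + 1) y))) = R n (D y) := by
    ext f
    change D _ f = D _ f
    rw [← sub_eq_zero, ← Pi.sub_apply, ← map_sub]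
    refine hD _ _ fun f' hf' => ?_
    have : δ f = n := f.2
    rw [Pi.sub_apply, hER _ _ _ (by omega), sub_self]
  have hAR (y : X → k) : A (E 0 (R 0 y)) = A y := by
    rw [← sub_eq_zero, ← map_sub]
    exact hA _ fun f hf => by rw [Pi.sub_apply, hER _ _ _ hf, sub_self]
  let d (n : ℕ) : (funRep k G (S (n + 1))).asModule →ₗ[MonoidAlgebra k G]
      (funRep k G (S n)).asModule :=
    Representation.asModuleMap _ _ (R n ∘ₗ D ∘ₗ E (n + 1)) fun g x => by
      simp only [LinearMap.comp_apply, E, SubMulAction.extendZero_funRep, hDG]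
      rfl
  let ε : (funRep k G (S 0)).asModule →ₗ[MonoidAlgebra k G]
      (Representation.trivial k G k).asModule :=
    Representation.asModuleMap _ _ (A ∘ₗ E 0) fun g x => by
      simp only [LinearMap.comp_apply, E, SubMulAction.extendZero_funRep, hAG]
      rfl
  obtain ⟨N, hN⟩ := (Set.finite_range δ).bddAbove
  refine ⟨N, fun n => ModuleCat.of _ (funRep k G (S n)).asModule, fun n => ModuleCat.ofHom (d n),
    ModuleCat.ofHom ε, fun n => isPermutationModule_iff.2
      ⟨S n, inferInstance, inferInstance, ⟨LinearEquiv.refl _ _⟩⟩, fun n hn => ?_,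
    fun n hn => ?_, ?_, ?_, fun n => ?_⟩
  · exact free_funRep_asModule fun g x hx =>
      hfree g x (le_of_eq_of_le x.2 hn) (congrArg Subtype.val hx)
  · have : IsEmpty (S n) := ⟨fun x => by
      have h1 : δ x ≤ N := hN ⟨x, rfl⟩
      have h2 : δ x = n := x.2
      omega⟩
    exact inferInstanceAs (Subsingleton (S n → k))
  · intro (c : k)
    obtain ⟨x, hx⟩ := hsurj
    refine ⟨R 0 (c • x), ?_⟩
    change A (E 0 (R 0 (c • x))) = c
    rw [hAR, map_smul, hx, smul_eq_mul, mul_one]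
  · intro x
    constructor
    · intro (hx : A (E 0 x) = 0)
      have h0 : D (E 0 x) = 0 := by
        ext f
        exact hD _ _ fun f' hf' => hE _ _ _ (by omega)
      obtain ⟨y, hy⟩ := hex _ h0 hx
      refine ⟨R 1 y, ?_⟩
      change R 0 (D (E 1 (R 1 y))) = x
      rw [hDR, hy]
      exact hRE _ x
    · rintro ⟨y, rfl⟩
      change A (E 0 (R 0 (D (E 1 y)))) = 0
      rw [hAR, hAD]
  · intro (x : S (n + 1) → k)
    constructor
    · intro (hx : R n (D (E (n + 1) x)) = 0)
      have h0 : D (E (n + 1) x) = 0 := by rw [← hdE, hx, map_zero]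
      obtain ⟨y, hy⟩ := hex _ h0 (hA _ fun f hf => hE _ _ _ (by omega))
      refine ⟨R (n + 1 + 1) y, ?_⟩
      change R (n + 1) (D (E (n + 1 + 1) (R (n + 1 + 1) y))) = x
      rw [hDR, hy]
      exact hRE _ x
    · rintro ⟨(y : S (n + 1 + 1) → k), rfl⟩
      change R n (D (E (n + 1) (R (n + 1) (D (E (n + 1 + 1) y))))) = 0
      rw [hdE (n + 1), hDD, map_zero]

end GradedResolution

section TensorPowerAction

set_option linter.unusedSectionVars false

variable {k G I Y : Type*} [CommRing k] [Group G] [Fintype I] [DecidableEq I] [Fintype Y]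
  [DecidableEq Y] [MulAction G I] [MulAction G (I → Y)]

theorem smul_update_of_smul_apply {u : G → I → Equiv.Perm Y}
    (hu : ∀ (g : G) (f : I → Y) i, (g • f) (g • i) = u g i (f i)) (g : G) (f : I → Y) (i : I)
    (w : Y) : g • Function.update f i w = Function.update (g • f) (g • i) (u g i w) := by
  ext j
  obtain ⟨j, rfl⟩ := MulAction.surjective g j
  rw [hu]
  by_cases h : j = i
  · subst h; simp
  · rw [Function.update_of_ne h, Function.update_of_ne (by simpa using h), hu]

theorem totalDeg_smul {deg : Y → ℕ} {u : G → I → Equiv.Perm Y}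
    (hu : ∀ (g : G) (f : I → Y) i, (g • f) (g • i) = u g i (f i))
    (hdeg : ∀ g i y, deg (u g i y) = deg y) (g : G) (f : I → Y) :
    totalDeg deg (g • f) = totalDeg deg f := by
  rw [totalDeg, ← Equiv.sum_comp (MulAction.toPerm g)]
  simp [hu, hdeg, totalDeg]

theorem tensorAug_funRep {deg : Y → ℕ} {u : G → I → Equiv.Perm Y}
    (hu : ∀ (g : G) (f : I → Y) i, (g • f) (g • i) = u g i (f i))
    (hdeg : ∀ g i y, deg (u g i y) = deg y) (g : G) (x : (I → Y) → k) :
    tensorAug k deg (funRep k G (I → Y) g x) = tensorAug k deg x := by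
  rw [tensorAug_apply, tensorAug_apply, Finset.sum_filter, Finset.sum_filter,
    ← Equiv.sum_comp (MulAction.toPerm g)]
  simp [totalDeg_smul hu hdeg]

theorem tensorDiff_funRep {σ : I → I → k} {deg : Y → ℕ} {a : Matrix Y Y k}
    {u : G → I → Equiv.Perm Y}
    (hu : ∀ (g : G) (f : I → Y) i, (g • f) (g • i) = u g i (f i))
    (hdeg : ∀ g i y, deg (u g i y) = deg y) (ha : ∀ g i y w, a (u g i y) (u g i w) = a y w)
    (hσ : ∀ (g : G) i j, σ (g • i) (g • j) = σ i j) (g : G) (x : (I → Y) → k) :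
    tensorDiff σ deg a (funRep k G (I → Y) g x) =
      funRep k G (I → Y) g (tensorDiff σ deg a x) := by
  ext f
  obtain ⟨f, rfl⟩ := MulAction.surjective g f
  beta_reduce
  rw [funRep_apply, inv_smul_smul, tensorDiff_apply, tensorDiff_apply, Finset.sum_apply,
    Finset.sum_apply, ← Equiv.sum_comp (MulAction.toPerm g)]
  refine Finset.sum_congr rfl fun i _ => ?_
  rw [MulAction.toPerm_apply, liftAt_apply, liftAt_apply]
  congr 1
  · rw [koszulSign, ← Equiv.prod_comp (MulAction.toPerm g)]
    simp [hσ, hu, hdeg, koszulSign]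
  · rw [← Equiv.sum_comp (u g i)]
    refine Finset.sum_congr rfl fun w _ => ?_
    rw [hu, ha, funRep_apply, ← smul_update_of_smul_apply hu, inv_smul_smul]

end TensorPowerAction

/-- The tensor power of a contractible complex of permutation modules is a permutation resolution
of the trivial module. -/
theorem IsSignSystem.hasPermResFreeUpTo_trivial {k G I Y : Type} [Field k] [Group G] [Finite G]
    [Fintype I] [DecidableEq I] [Fintype Y] [DecidableEq Y] [MulAction G I] [MulAction G (I → Y)]
    {σ : I → I → k} (hσ : IsSignSystem σ) (hσG : ∀ (g : G) i j, σ (g • i) (g • j) = σ i j)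
    {deg : Y → ℕ} {u : G → I → Equiv.Perm Y}
    (hu : ∀ (g : G) (f : I → Y) i, (g • f) (g • i) = u g i (f i))
    (hdeg : ∀ g i y, deg (u g i y) = deg y) {a b : Matrix Y Y k} {y₀ : Y} (hy₀ : deg y₀ = 0)
    (haG : ∀ g i y w, a (u g i y) (u g i w) = a y w)
    (ha : ∀ y w, a y w ≠ 0 → deg w = deg y + 1)
    (hb : ∀ y w, b y w ≠ 0 → deg y = deg w + 1) (haa : a * a = 0)
    (ha₀ : ∀ w, ∑ y with deg y = 0, a y w = 0)
    (hab : a * b + b * a = 1 - Matrix.of fun y w => if y = y₀ ∧ deg w = 0 then 1 else 0)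
    (m : ℕ) (hfree : ∀ (g : G) (f : I → Y), (∀ i, deg (f i) ≤ m) → g • f = f → g = 1) :
    HasPermResFreeUpTo k G m (Representation.trivial k G k).asModule := by
  have ha' : ∀ y w, a y w ≠ 0 → Odd (deg y + deg w) := fun y w h =>
    ⟨deg y, by rw [ha y w h]; ring⟩
  have hb' : ∀ y w, b y w ≠ 0 → Odd (deg y + deg w) := fun y w h =>
    ⟨deg w, by rw [hb y w h]; ring⟩
  refine hasPermResFreeUpTo_trivial_of_graded m (totalDeg deg) (totalDeg_smul hu hdeg)
    (fun g f hf => hfree g f fun i => ?_) (tensorDiff σ deg a) (tensorAug k deg)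
    (tensorDiff_funRep hu hdeg haG hσG) (tensorAug_funRep hu hdeg) (fun x f h => ?_)
    (fun x h => ?_) (hσ.tensorDiff_tensorDiff ha' haa) (tensorAug_tensorDiff σ ha₀)
    (hσ.exists_tensorDiff_eq hy₀ ha' hb' haa ha₀ hab) ⟨Pi.single (fun _ => y₀) 1, ?_⟩
  · exact (Finset.single_le_sum (f := fun i => deg (f i)) (fun _ _ => Nat.zero_le _)
      (Finset.mem_univ i)).trans hf
  · rw [tensorDiff_apply, Finset.sum_apply]
    refine Finset.sum_eq_zero fun i _ => ?_
    rw [liftAt_apply, Finset.sum_eq_zero, mul_zero]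
    intro w _
    by_cases hw : a (f i) w = 0
    · rw [hw, zero_mul]
    · have h1 := totalDeg_update deg f i w
      have h2 := ha _ _ hw
      rw [h _ (by omega), mul_zero]
  · rw [tensorAug_apply]
    exact Finset.sum_eq_zero fun f hf => h f (Finset.mem_filter.1 hf).2
  · rw [tensorAug_apply, Finset.sum_eq_single_of_mem (fun _ => y₀) (by simp [totalDeg, hy₀])
      (fun f _ hf => Pi.single_eq_of_ne hf _), Pi.single_eq_same]

section PeriodicComplex

set_option linter.unusedSectionVars false

variable (k : Type*) [CommRing k] (p : ℕ) [NeZero p]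

/-- The difference of a function on `ZMod p` and its translate. -/
def cyclicDiff : (ZMod p → k) →ₗ[k] (ZMod p → k) :=
  LinearMap.funLeft k k (· + 1) - LinearMap.id

/-- The norm of a function on `ZMod p`: the sum of its values, as a constant function. -/
def cyclicNorm : (ZMod p → k) →ₗ[k] (ZMod p → k) :=
  LinearMap.pi fun _ => ∑ s, LinearMap.proj s

/-- Summation, inverting `cyclicDiff` up to the sum of the values. -/
def cyclicSum : (ZMod p → k) →ₗ[k] (ZMod p → k) :=
  LinearMap.pi fun s => ∑ i ∈ Finset.range s.val, LinearMap.proj (i : ZMod p) -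
    if s = 0 then 0 else ∑ i ∈ Finset.range p, LinearMap.proj (i : ZMod p)

/-- Restriction of a function on `ZMod p` to `0`. -/
def cyclicRestrict : (ZMod p → k) →ₗ[k] (ZMod p → k) :=
  LinearMap.single k (fun _ => k) 0 ∘ₗ LinearMap.proj 0

variable {k p}

theorem cyclicDiff_apply (φ : ZMod p → k) (s : ZMod p) :
    cyclicDiff k p φ s = φ (s + 1) - φ s := rfl

theorem cyclicNorm_apply (φ : ZMod p → k) (s : ZMod p) : cyclicNorm k p φ s = ∑ t, φ t := by
  simp [cyclicNorm]

theorem cyclicSum_apply (φ : ZMod p → k) (s : ZMod p) : cyclicSum k p φ s =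
    ∑ i ∈ Finset.range s.val, φ i - if s = 0 then 0 else ∑ i ∈ Finset.range p, φ i := by
  rw [cyclicSum, LinearMap.pi_apply, LinearMap.sub_apply]
  split_ifs <;> simp

theorem cyclicRestrict_apply (φ : ZMod p → k) : cyclicRestrict k p φ = Pi.single 0 (φ 0) := rfl

theorem ZMod.sum_range_natCast (φ : ZMod p → k) :
    ∑ i ∈ Finset.range p, φ i = ∑ s, φ s :=
  Finset.sum_nbij' (fun i => (i : ZMod p)) ZMod.val (by simp)
    (by simp [ZMod.val_lt]) (fun i hi => ZMod.val_cast_of_lt (Finset.mem_range.1 hi))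
    (by simp) (by simp)

theorem cyclicDiff_cyclicNorm (φ : ZMod p → k) : cyclicDiff k p (cyclicNorm k p φ) = 0 := by
  ext s
  simp [cyclicDiff_apply, cyclicNorm_apply]

theorem sum_cyclicDiff (φ : ZMod p → k) : ∑ s, cyclicDiff k p φ s = 0 := by
  simp only [cyclicDiff_apply, Finset.sum_sub_distrib, sub_eq_zero]
  exact Equiv.sum_comp (Equiv.addRight 1) φ

theorem cyclicNorm_cyclicDiff (φ : ZMod p → k) : cyclicNorm k p (cyclicDiff k p φ) = 0 := by
  ext s
  rw [cyclicNorm_apply, sum_cyclicDiff, Pi.zero_apply]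

theorem cyclicDiff_cyclicSum [Fact (1 < p)] (φ : ZMod p → k) (s : ZMod p) :
    cyclicDiff k p (cyclicSum k p φ) s = φ s - if s = 0 then ∑ t, φ t else 0 := by
  rw [cyclicDiff_apply, cyclicSum_apply, cyclicSum_apply]
  by_cases hs : s + 1 = 0
  · have hs0 : s ≠ 0 := by
      rintro rfl
      simp at hs
    have hv : s.val + 1 = p := by
      have h1 : ((s.val + 1 : ℕ) : ZMod p) = 0 := by simpa using hs
      have h2 := (ZMod.natCast_eq_zero_iff _ _).1 h1
      exact le_antisymm (ZMod.val_lt s) (Nat.le_of_dvd (Nat.succ_pos _) h2)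
    have h3 : ∑ i ∈ Finset.range p, φ i = ∑ i ∈ Finset.range s.val, φ i + φ s := by
      have := Finset.sum_range_succ (fun i : ℕ => φ i) s.val
      rw [hv] at this
      simpa using this
    rw [hs, if_neg hs0, if_neg hs0, h3]
    simp
  · have hv : (s + 1).val = s.val + 1 := by
      have h1 : s.val + 1 < p := by
        refine lt_of_le_of_ne (ZMod.val_lt s) fun h => hs ?_
        have h2 : ((s.val + 1 : ℕ) : ZMod p) = 0 := by rw [h]; simp
        simpa using h2
      rw [ZMod.val_add_of_lt (by rwa [ZMod.val_one]), ZMod.val_one]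
    rw [hv, Finset.sum_range_succ, if_neg hs, ZMod.sum_range_natCast]
    by_cases hs0 : s = 0
    · simp [hs0]
    · simp [hs0]

theorem cyclicSum_cyclicDiff (φ : ZMod p → k) (s : ZMod p) :
    cyclicSum k p (cyclicDiff k p φ) s = φ s - φ 0 := by
  have h (n : ℕ) : ∑ i ∈ Finset.range n, cyclicDiff k p φ i = φ n - φ 0 := by
    have := Finset.sum_range_sub (fun i : ℕ => φ i) n
    simpa [cyclicDiff_apply] using this
  rw [cyclicSum_apply, h, h]
  simp

theorem cyclicNorm_cyclicRestrict (φ : ZMod p → k) (s : ZMod p) :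
    cyclicNorm k p (cyclicRestrict k p φ) s = φ 0 := by
  simp [cyclicNorm_apply, cyclicRestrict_apply]

theorem cyclicRestrict_cyclicNorm (φ : ZMod p → k) (s : ZMod p) :
    cyclicRestrict k p (cyclicNorm k p φ) s = if s = 0 then ∑ t, φ t else 0 := by
  rw [cyclicRestrict_apply, Pi.single_apply, cyclicNorm_apply]

/-- The differential from degree `i + 1` to degree `i` of the periodic complex. -/
def periodicDiff (k : Type*) [CommRing k] (p : ℕ) [NeZero p] (i : ℕ) :
    (ZMod p → k) →ₗ[k] (ZMod p → k) :=
  if Even i then cyclicDiff k p else cyclicNorm k p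

/-- The contracting homotopy from degree `i` to degree `i + 1` of the periodic complex. -/
def periodicHomotopy (k : Type*) [CommRing k] (p : ℕ) [NeZero p] (i : ℕ) :
    (ZMod p → k) →ₗ[k] (ZMod p → k) :=
  if Even i then cyclicSum k p else cyclicRestrict k p

theorem periodicDiff_periodicDiff (i : ℕ) (φ : ZMod p → k) :
    periodicDiff k p i (periodicDiff k p (i + 1) φ) = 0 := by
  by_cases h : Even i <;> simp [periodicDiff, h, Nat.even_add_one, cyclicDiff_cyclicNorm,
    cyclicNorm_cyclicDiff]

theorem periodicDiff_zero_periodicHomotopy [Fact (1 < p)] (φ : ZMod p → k) (s : ZMod p) :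
    periodicDiff k p 0 (periodicHomotopy k p 0 φ) s =
      φ s - if s = 0 then ∑ t, φ t else 0 := by
  simp [periodicDiff, periodicHomotopy, cyclicDiff_cyclicSum]

theorem periodicDiff_succ_periodicHomotopy [Fact (1 < p)] (i : ℕ) (φ : ZMod p → k) (s : ZMod p) :
    periodicDiff k p (i + 1) (periodicHomotopy k p (i + 1) φ) s +
      periodicHomotopy k p i (periodicDiff k p i φ) s = φ s := by
  by_cases h : Even i <;> simp [periodicDiff, periodicHomotopy, h, Nat.even_add_one,
    cyclicDiff_cyclicSum, cyclicSum_cyclicDiff, cyclicNorm_cyclicRestrict,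
    cyclicRestrict_cyclicNorm]

theorem periodicDiff_single_add (i : ℕ) (c s t : ZMod p) :
    periodicDiff k p i (Pi.single (c + t) 1) (c + s) = periodicDiff k p i (Pi.single t 1) s := by
  by_cases h : Even i
  · simp [periodicDiff, h, cyclicDiff_apply, Pi.single_apply, add_assoc]
  · simp [periodicDiff, h, cyclicNorm_apply]

/-- The basis of the periodic complex, truncated by a one-dimensional space in degree `L`. -/
abbrev TruncBasis (p L : ℕ) : Type := (Fin L × ZMod p) ⊕ Unit

/-- The degree of a basis element of the truncated periodic complex. -/
def truncDeg {p L : ℕ} : TruncBasis p L → ℕ := Sum.elim (fun q => q.1) (fun _ => L)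

/-- Translation on the basis of the truncated periodic complex. -/
def truncTranslate (L : ℕ) (c : ZMod p) : Equiv.Perm (TruncBasis p L) :=
  Equiv.sumCongr (Equiv.prodCongr (Equiv.refl _) (Equiv.addLeft c)) (Equiv.refl _)

/-- The component of degree `j` of the inclusion of the truncated periodic complex into the
periodic complex. -/
def truncIncl (k : Type*) [CommRing k] (p L j : ℕ) :
    (TruncBasis p L → k) →ₗ[k] (ZMod p → k) :=
  if h : j < L then LinearMap.funLeft k k fun s => Sum.inl (⟨j, h⟩, s)
  else if j = L then LinearMap.single k (fun _ => k) 0 ∘ₗ LinearMap.proj (Sum.inr ())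
  else 0

theorem truncIncl_of_lt {L j : ℕ} (h : j < L) (x : TruncBasis p L → k) (s : ZMod p) :
    truncIncl k p L j x s = x (Sum.inl (⟨j, h⟩, s)) := by
  simp [truncIncl, h, LinearMap.funLeft_apply]

theorem truncIncl_self {L : ℕ} (x : TruncBasis p L → k) :
    truncIncl k p L L x = Pi.single 0 (x (Sum.inr ())) := by
  simp [truncIncl]

theorem truncIncl_single_of_ne {L j : ℕ} {y : TruncBasis p L} (h : truncDeg y ≠ j) :
    truncIncl k p L j (Pi.single y 1) = 0 := by
  rcases lt_trichotomy j L with hj | rfl | hj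
  · ext s
    rw [truncIncl_of_lt hj, Pi.single_eq_of_ne, Pi.zero_apply]
    rintro rfl
    exact h rfl
  · rw [truncIncl_self, Pi.single_eq_of_ne, Pi.single_zero]
    rintro rfl
    exact h rfl
  · simp [truncIncl, hj.not_gt, hj.ne']

theorem truncIncl_single_inl {L : ℕ} (j : Fin L) (t : ZMod p) :
    truncIncl k p L j (Pi.single (Sum.inl (j, t)) 1) = Pi.single t 1 := by
  ext s
  simp [truncIncl_of_lt j.2, Pi.single_apply]

/-- The differential of the truncated periodic complex. -/
def truncDiff (k : Type*) [CommRing k] (p : ℕ) [NeZero p] (L : ℕ) :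
    (TruncBasis p L → k) →ₗ[k] (TruncBasis p L → k) :=
  LinearMap.pi (Sum.elim
    (fun q => LinearMap.proj q.2 ∘ₗ periodicDiff k p q.1 ∘ₗ truncIncl k p L (q.1 + 1)) 0)

/-- The contracting homotopy of the truncated periodic complex. -/
def truncHomotopy (k : Type*) [CommRing k] (p : ℕ) [NeZero p] (L : ℕ) :
    (TruncBasis p L → k) →ₗ[k] (TruncBasis p L → k) :=
  LinearMap.pi (Sum.elim
    (fun q => if (q.1 : ℕ) = 0 then 0 else
      LinearMap.proj q.2 ∘ₗ periodicHomotopy k p (q.1 - 1) ∘ₗ truncIncl k p L (q.1 - 1))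
    (fun _ => LinearMap.proj 0 ∘ₗ truncIncl k p L (L - 1)))

theorem truncDiff_inl {L : ℕ} (x : TruncBasis p L → k) (i : Fin L) (s : ZMod p) :
    truncDiff k p L x (Sum.inl (i, s)) =
      periodicDiff k p i (truncIncl k p L (i + 1) x) s := rfl

theorem truncDiff_inr {L : ℕ} (x : TruncBasis p L → k) :
    truncDiff k p L x (Sum.inr ()) = 0 := rfl

theorem truncHomotopy_inl_zero {L : ℕ} (x : TruncBasis p L → k) {i : Fin L} (hi : (i : ℕ) = 0)
    (s : ZMod p) : truncHomotopy k p L x (Sum.inl (i, s)) = 0 := by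
  simp [truncHomotopy, hi]

theorem truncHomotopy_inl_succ {L : ℕ} (x : TruncBasis p L → k) {i : Fin L} {j : ℕ}
    (hi : (i : ℕ) = j + 1) (s : ZMod p) : truncHomotopy k p L x (Sum.inl (i, s)) =
      periodicHomotopy k p j (truncIncl k p L j x) s := by
  simp [truncHomotopy, hi]

theorem truncHomotopy_inr {L : ℕ} (x : TruncBasis p L → k) :
    truncHomotopy k p L x (Sum.inr ()) = truncIncl k p L (L - 1) x 0 := rfl

theorem truncIncl_truncDiff {L j : ℕ} (h : j < L) (x : TruncBasis p L → k) :
    truncIncl k p L j (truncDiff k p L x) = periodicDiff k p j (truncIncl k p L (j + 1) x) := by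
  ext s
  rw [truncIncl_of_lt h, truncDiff_inl]

theorem truncIncl_self_truncDiff {L : ℕ} (x : TruncBasis p L → k) :
    truncIncl k p L L (truncDiff k p L x) = 0 := by
  rw [truncIncl_self, truncDiff_inr, Pi.single_zero]

theorem truncIncl_succ_truncHomotopy {L j : ℕ} (hL : Even L) (h : j < L)
    (x : TruncBasis p L → k) : truncIncl k p L (j + 1) (truncHomotopy k p L x) =
      periodicHomotopy k p j (truncIncl k p L j x) := by
  rcases Nat.lt_or_ge (j + 1) L with h' | h'
  · ext s
    rw [truncIncl_of_lt h', truncHomotopy_inl_succ x rfl]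
  · obtain rfl : L = j + 1 := le_antisymm h' h
    rw [truncIncl_self, truncHomotopy_inr, Nat.add_sub_cancel, periodicHomotopy,
      if_neg (by simpa [Nat.even_add_one] using hL), cyclicRestrict_apply]

theorem truncDiff_truncDiff (L : ℕ) (x : TruncBasis p L → k) :
    truncDiff k p L (truncDiff k p L x) = 0 := by
  ext y
  rcases y with ⟨i, s⟩ | ⟨⟩
  · rw [truncDiff_inl]
    rcases Nat.lt_or_ge (i + 1) L with h | h
    · rw [truncIncl_truncDiff h, periodicDiff_periodicDiff]
      rfl
    · have h' : (i : ℕ) + 1 = L := le_antisymm i.2 h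
      rw [h', truncIncl_self_truncDiff, map_zero]
      rfl
  · rfl

theorem truncDiff_truncHomotopy [Fact (1 < p)] {L : ℕ} (hL : Even L) (hL₀ : 0 < L)
    (x : TruncBasis p L → k) (y : TruncBasis p L) :
    truncDiff k p L (truncHomotopy k p L x) y + truncHomotopy k p L (truncDiff k p L x) y =
      x y - if y = Sum.inl (⟨0, hL₀⟩, 0) then ∑ t, x (Sum.inl (⟨0, hL₀⟩, t)) else 0 := by
  rcases y with ⟨⟨i, hi⟩, s⟩ | ⟨⟩
  · rw [truncDiff_inl, truncIncl_succ_truncHomotopy hL hi]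
    rcases i with _ | i
    · rw [truncHomotopy_inl_zero _ rfl, periodicDiff_zero_periodicHomotopy, add_zero]
      simp [truncIncl_of_lt hL₀]
    · rw [truncHomotopy_inl_succ _ rfl, truncIncl_truncDiff (by omega),
        periodicDiff_succ_periodicHomotopy, truncIncl_of_lt hi]
      simp
  · have h : L - 1 + 1 = L := by omega
    have h' : ¬ Even (L - 1) := by rwa [← h, Nat.even_add_one] at hL
    rw [truncDiff_inr, truncHomotopy_inr, truncIncl_truncDiff (by omega), h, truncIncl_self,
      periodicDiff, if_neg h', cyclicNorm_apply]
    simp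

theorem truncTranslate_apply_ne {L : ℕ} {c : ZMod p} (hc : c ≠ 0) {y : TruncBasis p L}
    (hy : truncDeg y < L) : truncTranslate L c y ≠ y := by
  rcases y with ⟨i, s⟩ | ⟨⟩
  · simpa [truncTranslate] using hc
  · exact absurd hy (lt_irrefl _)

theorem truncDeg_truncTranslate {L : ℕ} (c : ZMod p) (y : TruncBasis p L) :
    truncDeg (truncTranslate L c y) = truncDeg y := by
  rcases y with ⟨i, s⟩ | ⟨⟩ <;> rfl

/-- The matrices of the differential and of the contracting homotopy of the truncated periodic
complex. -/
theorem exists_truncDiff_matrix [Fact (1 < p)] {L : ℕ} (hL : Even L) (hL₀ : 0 < L) :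
    ∃ a b : Matrix (TruncBasis p L) (TruncBasis p L) k,
      (∀ c y w, a (truncTranslate L c y) (truncTranslate L c w) = a y w) ∧
      (∀ y w, a y w ≠ 0 → truncDeg w = truncDeg y + 1) ∧
      (∀ y w, b y w ≠ 0 → truncDeg y = truncDeg w + 1) ∧
      a * a = 0 ∧
      (∀ w, ∑ y with truncDeg y = 0, a y w = 0) ∧
      a * b + b * a = 1 - Matrix.of fun y w =>
        if y = Sum.inl (⟨0, hL₀⟩, 0) ∧ truncDeg w = 0 then 1 else 0 := by
  have hentry (f : (TruncBasis p L → k) →ₗ[k] (TruncBasis p L → k)) (y w) :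
      LinearMap.toMatrix' f y w = f (Pi.single w 1) y := by
    simp [LinearMap.toMatrix'_apply]
  refine ⟨LinearMap.toMatrix' (truncDiff k p L), LinearMap.toMatrix' (truncHomotopy k p L),
    fun c y w => ?_, fun y w h => ?_, fun y w h => ?_, ?_, fun w => ?_, ?_⟩
  · rw [hentry, hentry]
    rcases y with ⟨i, s⟩ | ⟨⟩
    · change periodicDiff k p i _ (c + s) = periodicDiff k p i _ s
      by_cases hw : truncDeg w = i + 1
      · rcases w with ⟨j, t⟩ | ⟨⟩
        · change (j : ℕ) = i + 1 at hw
          change periodicDiff k p i (truncIncl k p L (i + 1)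
            (Pi.single (Sum.inl (j, c + t)) 1)) (c + s) = _
          rw [← hw, truncIncl_single_inl, truncIncl_single_inl, periodicDiff_single_add]
        · change L = i + 1 at hw
          change periodicDiff k p i (truncIncl k p L (i + 1) (Pi.single (Sum.inr ()) 1)) _ = _
          rw [periodicDiff, if_neg (by simpa [hw, Nat.even_add_one] using hL),
            cyclicNorm_apply, cyclicNorm_apply]
      · rw [truncIncl_single_of_ne hw, truncIncl_single_of_ne (by
          rwa [truncDeg_truncTranslate]), map_zero]
        rfl
    · rfl
  · rw [hentry] at h
    by_contra hw
    rcases y with ⟨i, s⟩ | ⟨⟩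
    · change ¬ truncDeg w = i + 1 at hw
      rw [truncDiff_inl, truncIncl_single_of_ne hw, map_zero] at h
      exact h rfl
    · exact h rfl
  · rw [hentry] at h
    by_contra hw
    rcases y with ⟨⟨_ | i, hi⟩, s⟩ | ⟨⟩
    · exact h (truncHomotopy_inl_zero _ rfl s)
    · rw [truncHomotopy_inl_succ _ rfl, truncIncl_single_of_ne fun h' => hw ?_, map_zero] at h
      · exact h rfl
      · rw [h']
        rfl
    · rw [truncHomotopy_inr, truncIncl_single_of_ne fun h' => hw ?_] at h
      · exact h rfl
      · rw [h']
        change L = _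
        omega
  · have h : truncDiff k p L ∘ₗ truncDiff k p L = 0 := LinearMap.ext (truncDiff_truncDiff L)
    rw [← LinearMap.toMatrix'_comp, h, map_zero]
  · simp only [hentry, Finset.sum_filter]
    rw [Fintype.sum_sum_type, Fintype.sum_prod_type,
      Finset.sum_eq_single_of_mem (⟨0, hL₀⟩ : Fin L) (Finset.mem_univ _)]
    · have h : ∀ s : ZMod p, truncDeg (Sum.inl (⟨0, hL₀⟩, s) : TruncBasis p L) = 0 := fun _ => rfl
      have h' : truncDeg (Sum.inr () : TruncBasis p L) ≠ 0 := hL₀.ne'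
      simp only [h, h', if_true, if_false, truncDiff_inl, Finset.sum_const_zero, add_zero]
      simp [periodicDiff, sum_cyclicDiff]
    · intro j _ hj
      refine Finset.sum_eq_zero fun s _ => if_neg fun h => hj (Fin.ext h)
  · ext y w
    rw [← LinearMap.toMatrix'_comp, ← LinearMap.toMatrix'_comp, Matrix.add_apply, hentry, hentry,
      LinearMap.comp_apply, LinearMap.comp_apply, truncDiff_truncHomotopy hL hL₀,
      Matrix.sub_apply, Matrix.of_apply, Matrix.one_apply, Pi.single_apply, ite_and]
    congr 2
    rcases w with ⟨j, t⟩ | ⟨⟩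
    · by_cases hj : j = ⟨0, hL₀⟩
      · subst hj
        simp [truncDeg, Pi.single_apply]
      · have hj' : (j : ℕ) ≠ 0 := fun h => hj (Fin.ext h)
        simp [truncDeg, hj', Ne.symm hj]
    · simp [truncDeg, hL₀.ne']

end PeriodicComplex

theorem exists_invariant_isSignSystem {k G I : Type*} [CommRing k] [Group G] [Finite G]
    [Finite I] [MulAction G I] (h : (-1 : k) ^ Nat.card G = -1) :
    ∃ σ : I → I → k, IsSignSystem σ ∧ ∀ (g : G) i j, σ (g • i) (g • j) = σ i j := by
  have := Fintype.ofFinite G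
  obtain ⟨n, ⟨e⟩⟩ := Finite.exists_equiv_fin I
  let s (i j : I) : k := if e i < e j then -1 else 1
  refine ⟨fun i j => ∏ g : G, s (g • i) (g • j), ⟨fun i => ?_, fun i j => ?_, fun i j hij => ?_⟩,
    fun g i j => ?_⟩
  · simp [s]
  · rw [← Finset.prod_mul_distrib]
    refine Finset.prod_eq_one fun g _ => ?_
    dsimp only [s]
    split_ifs <;> simp
  · have hs (g : G) : s (g • i) (g • j) = -1 * s (g • j) (g • i) := by
      have hne : e (g • i) ≠ e (g • j) := fun h => hij (by simpa using h)
      dsimp only [s]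
      rcases lt_or_gt_of_ne hne with h | h
      · simp [h, h.not_gt]
      · simp [h, h.not_gt]
    rw [Finset.prod_congr rfl fun g _ => hs g, Finset.prod_mul_distrib, Finset.prod_const,
      Finset.card_univ, ← Nat.card_eq_fintype_card, h, neg_one_mul]
  · simp only [← mul_smul]
    exact Equiv.prod_comp (Equiv.mulRight g) fun x => s (x • i) (x • j)

/-- The cocycle on `G ⧸ H` obtained by inducing a character of `H`. -/
theorem exists_cocycle_quotient {G A : Type*} [Group G] [CommGroup A] {H : Subgroup G}
    (χ : H →* A) : ∃ c : G → G ⧸ H → A, (∀ g h q, c (g * h) q = c g (h • q) * c h q) ∧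
      ∀ h : H, c h ((1 : G) : G ⧸ H) = χ h := by
  have hmem (g : G) (q : G ⧸ H) : (g • q).out⁻¹ * (g * q.out) ∈ H := by
    rw [← QuotientGroup.eq, QuotientGroup.out_eq', ← smul_eq_mul,
      ← MulAction.Quotient.smul_coe, QuotientGroup.out_eq']
  refine ⟨fun g q => χ ⟨_, hmem g q⟩, fun g h q => ?_, fun h => ?_⟩
  · rw [← map_mul]
    refine congrArg χ (Subtype.ext ?_)
    simp only [Subgroup.coe_mul, mul_smul]
    group
  · have h1 : (h : G) • ((1 : G) : G ⧸ H) = ((1 : G) : G ⧸ H) := by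
      rw [MulAction.Quotient.smul_coe, smul_eq_mul, mul_one, QuotientGroup.eq, mul_one]
      exact H.inv_mem h.2
    have h2 : (((1 : G) : G ⧸ H)).out ∈ H := by
      have := QuotientGroup.out_eq' ((1 : G) : G ⧸ H)
      rw [eq_comm, QuotientGroup.eq] at this
      simpa using this
    have h3 : (⟨_, hmem h ((1 : G) : G ⧸ H)⟩ : H) = (⟨_, h2⟩ : H)⁻¹ * (h * ⟨_, h2⟩) := by
      ext
      simp [h1]
    beta_reduce
    rw [h3, map_mul, map_mul, map_inv]
    exact inv_mul_cancel_comm_assoc _ _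

/-- A finite group acts on a finite set with a cocycle which is nonzero on each element of
order `p` at one of its fixed points. -/
theorem exists_cocycle_ne_zero (p : ℕ) [Fact p.Prime] (G : Type) [Group G] [Finite G] :
    ∃ (I : Type) (_ : Finite I) (_ : MulAction G I) (c : G → I → ZMod p),
      (∀ g h i, c (g * h) i = c g (h • i) + c h i) ∧
      ∀ z : G, orderOf z = p → ∃ i, z • i = i ∧ c z i ≠ 0 := by
  have hχ (z : {z : G // orderOf z = p}) :
      Nonempty (Subgroup.zpowers z.1 ≃* Multiplicative (ZMod p)) :=
    ⟨mulEquivOfPrimeCardEq (p := p) (by rw [Nat.card_zpowers, z.2]) (by simp)⟩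
  let χ (z) := (hχ z).some
  choose c hc hc₁ using fun z => exists_cocycle_quotient (χ z).toMonoidHom
  refine ⟨Σ z : {z : G // orderOf z = p}, G ⧸ Subgroup.zpowers z.1, inferInstance, inferInstance,
    fun g i => (c i.1 g i.2).toAdd, fun g h i => ?_, fun z hz =>
      ⟨⟨⟨z, hz⟩, ((1 : G) : G ⧸ Subgroup.zpowers z)⟩, ?_, ?_⟩⟩
  · change (c i.1 (g * h) i.2).toAdd = (c i.1 g (h • i.2)).toAdd + (c i.1 h i.2).toAdd
    rw [hc]
    rfl
  · rw [Sigma.smul_def]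
    refine Sigma.ext rfl (heq_of_eq ?_)
    change ((z * 1 : G) : G ⧸ Subgroup.zpowers z) = ((1 : G) : G ⧸ Subgroup.zpowers z)
    rw [QuotientGroup.eq, mul_one, mul_one]
    exact Subgroup.inv_mem _ (Subgroup.mem_zpowers z)
  · have h := hc₁ ⟨z, hz⟩ ⟨z, Subgroup.mem_zpowers z⟩
    intro h0
    have h1 : (χ ⟨z, hz⟩) ⟨z, Subgroup.mem_zpowers z⟩ = 1 := by
      rw [← toAdd_eq_zero]
      rw [← h0]
      exact congrArg Multiplicative.toAdd h.symm
    rw [map_eq_one_iff _ (χ ⟨z, hz⟩).injective] at h1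
    have h2 : z = 1 := congrArg Subtype.val h1
    rw [h2, orderOf_one] at hz
    exact (Fact.out : p.Prime).one_lt.ne hz

/-- The trivial module of a finite `p`-group in characteristic `p` has good permutation
resolutions. -/
theorem IsPGroup.hasGoodPermRes_trivial {p : ℕ} [Fact p.Prime] {k G : Type} [Field k] [CharP k p]
    [Group G] [Finite G] (hG : IsPGroup p G) :
    HasGoodPermRes k G (Representation.trivial k G k).asModule := by
  classical
  intro m
  obtain ⟨I, _, _, c, hc, hcz⟩ := exists_cocycle_ne_zero p G
  have := Fintype.ofFinite I
  have : Fact (1 < p) := ⟨(Fact.out : p.Prime).one_lt⟩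
  have hcard : (-1 : k) ^ Nat.card G = -1 := by
    obtain ⟨n, hn⟩ := IsPGroup.iff_card.1 hG
    rw [hn]
    exact neg_one_pow_char_pow k p n
  obtain ⟨σ, hσ, hσG⟩ := exists_invariant_isSignSystem (I := I) hcard
  let L := 2 * (m + 1)
  obtain ⟨a, b, haG, ha, hb, haa, ha₀, hab⟩ :=
    exists_truncDiff_matrix (k := k) (p := p) (L := L) (even_two_mul _) (by positivity)
  let u (g : G) (i : I) : Equiv.Perm (TruncBasis p L) := truncTranslate L (c g i)
  have hu₁ (i : I) (y) : u 1 i y = y := by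
    have h := hc 1 1 i
    rw [mul_one, one_smul, left_eq_add] at h
    simp only [u, h]
    rcases y with ⟨j, s⟩ | ⟨⟩ <;> simp [truncTranslate]
  have hu_mul (g h : G) (i : I) (y) : u (g * h) i y = u g (h • i) (u h i y) := by
    simp only [u, hc]
    rcases y with ⟨j, s⟩ | ⟨⟩ <;> simp [truncTranslate, add_assoc]
  let _ : MulAction G (I → TruncBasis p L) :=
    { smul := fun g f i => u g (g⁻¹ • i) (f (g⁻¹ • i))
      one_smul := fun f => by
        funext i
        change u 1 (1⁻¹ • i) (f (1⁻¹ • i)) = f i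
        rw [hu₁, inv_one, one_smul]
      mul_smul := fun g h f => by
        funext i
        change u (g * h) ((g * h)⁻¹ • i) (f ((g * h)⁻¹ • i)) =
          u g (g⁻¹ • i) (u h (h⁻¹ • g⁻¹ • i) (f (h⁻¹ • g⁻¹ • i)))
        rw [hu_mul, mul_inv_rev, mul_smul, smul_inv_smul] }
  have hu (g : G) (f : I → TruncBasis p L) (i : I) : (g • f) (g • i) = u g i (f i) := by
    change u g (g⁻¹ • g • i) (f (g⁻¹ • g • i)) = _
    rw [inv_smul_smul]
  refine hσ.hasPermResFreeUpTo_trivial hσG (deg := truncDeg) hu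
    (fun g i y => truncDeg_truncTranslate _ y) rfl (fun g i y w => haG _ y w) ha hb haa ha₀ hab m
    fun g f hf hgf => ?_
  by_contra hg
  have hnontriv : Nat.card (MulAction.stabilizer G f) ≠ 1 := fun h => hg (by
    have := (Subgroup.card_eq_one).1 h
    have hmem : g ∈ MulAction.stabilizer G f := hgf
    rwa [this, Subgroup.mem_bot] at hmem)
  obtain ⟨⟨z, hzf⟩, hz⟩ := exists_prime_orderOf_dvd_card' p
    (((hG.to_subgroup (MulAction.stabilizer G f)).card_eq_or_dvd).resolve_left hnontriv)
  obtain ⟨i, hi, hci⟩ := hcz z (by rwa [Subgroup.orderOf_mk] at hz)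
  have h := hu z f i
  rw [hi, MulAction.mem_stabilizer_iff.1 hzf] at h
  exact truncTranslate_apply_ne hci (y := f i) (lt_of_le_of_lt (hf i) (by omega)) h.symm

/-- For a finite `p`-group `G` and a field `k` of characteristic `p`, every
finite-dimensional `kG`-module `M` has a complement `N` such that `M ⊕ N` admits good
permutation resolutions; in particular for every `m ≥ 0` the module `M ⊕ N` has a
finite permutation resolution that is free up to degree `m`. -/
theorem exists_complement_with_good_permutation_resolutions
    (p : ℕ) (hp : p.Prime) (k : Type) [Field k] [CharP k p]
    (G : Type) [Group G] [Finite G] (hG : IsPGroup p G)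
    (M : Type) [AddCommGroup M] [Module (MonoidAlgebra k G) M]
    [Module.Finite (MonoidAlgebra k G) M] :
    ∃ (N : Type) (_ : AddCommGroup N) (_ : Module (MonoidAlgebra k G) N),
      Module.Finite (MonoidAlgebra k G) N ∧
      HasGoodPermRes k G (M × N) ∧
      ∀ m : ℕ, HasPermResFreeUpTo k G m (M × N) := by
  have : Fact p.Prime := ⟨hp⟩
  have h : HasGoodPermRes k G (M × PUnit) :=
    HasGoodPermRes.of_trivial hp hG hG.hasGoodPermRes_trivial (M × PUnit)
  exact ⟨PUnit, inferInstance, inferInstance, inferInstance, h, h⟩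
end
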